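/- arXiv:1905.04751 — 3 statements merged into one kernel-verified Lean document; each statement's English description precedes it below -/
import Mathlib

section
/- Every nonnegative ternary quartic is a sum of squares of homogeneous quadratic polynomials: if p(x,y,z) = Σ_{i+j+k=4} p_{ijk} x^i y^j z^k is a homogeneous real polynomial of degree 4 in three variables satisfying p(x,y,z) ≥ 0 for all real x, y, z, then there exist finitely many homogeneous quadratic polynomials q_1, …, q_m in x, y, z with real coefficients such that p = q_1^2 + ⋯ + q_m^2. -/
open MvPolynomial

/-- Functions on ℝ³ given by a homogeneous polynomial of degree `n`. -/
def IsForm (n : ℕ) (F : (Fin 3 → ℝ) → ℝ) : Prop :=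
  ∃ P : MvPolynomial (Fin 3) ℝ, P.IsHomogeneous n ∧ ∀ v, F v = eval v P

lemma IsForm.comp {n : ℕ} {F : (Fin 3 → ℝ) → ℝ} (h : IsForm n F) (A : Matrix (Fin 3) (Fin 3) ℝ) :
    IsForm n (fun v => F (A.mulVec v)) := by
  obtain ⟨P, hP, hF⟩ := h
  refine ⟨aeval (fun i => ∑ j, C (A i j) * X j) P, ?_, ?_⟩
  · have := hP.aeval (fun i => ∑ j, C (A i j) * X j : Fin 3 → MvPolynomial (Fin 3) ℝ) (n := 1)
      (fun i => IsHomogeneous.sum _ _ _ (fun j _ => isHomogeneous_C_mul_X _ _))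
    simpa using this
  · intro v
    change F (A.mulVec v) = _
    rw [hF]
    simp only [aeval_def, algebraMap_eq]
    rw [eval_eval₂]
    have : (eval v).comp (C : ℝ →+* MvPolynomial (Fin 3) ℝ) = RingHom.id ℝ := by
      ext; simp
    rw [this, eval₂_id]
    congr 1
    congr 1
    funext i
    simp [Matrix.mulVec, dotProduct]

lemma isForm_sum_eq {n : ℕ} {P : MvPolynomial (Fin 3) ℝ} (h : P.IsHomogeneous n) (v : Fin 3 → ℝ) :
    eval v P = ∑ d ∈ Finset.Nat.antidiagonalTuple 3 n,
      P.coeff (Finsupp.equivFunOnFinite.symm d) * (v 0 ^ d 0 * v 1 ^ d 1 * v 2 ^ d 2) := by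
  rw [eval_eq']
  simp only [Fin.prod_univ_three]
  have hs : P.support ⊆ (Finset.Nat.antidiagonalTuple 3 n).map
      Finsupp.equivFunOnFinite.symm.toEmbedding := by
    intro d hd
    have := h.degree_eq_sum_deg_support hd
    simp only [Finset.mem_map_equiv, Equiv.symm_symm, Finset.Nat.mem_antidiagonalTuple]
    rw [this]
    exact (Finset.sum_subset (Finset.subset_univ _) (by simp)).symm
  rw [Finset.sum_subset hs, Finset.sum_map]
  · rfl
  · intro d _ hd
    rw [notMem_support_iff.1 hd, zero_mul]

lemma IsForm.coeff2 {F : (Fin 3 → ℝ) → ℝ} (h : IsForm 2 F) :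
    ∃ c : Fin 6 → ℝ, ∀ v, F v = c 0 * v 0 ^ 2 + c 1 * v 1 ^ 2 + c 2 * v 2 ^ 2
      + c 3 * (v 0 * v 1) + c 4 * (v 0 * v 2) + c 5 * (v 1 * v 2) := by
  obtain ⟨P, hP, hF⟩ := h
  have e : Finset.Nat.antidiagonalTuple 3 2 =
    {![2,0,0], ![0,2,0], ![0,0,2], ![1,1,0], ![1,0,1], ![0,1,1]} := by decide
  let k : (Fin 3 → ℕ) → ℝ := fun d => P.coeff (Finsupp.equivFunOnFinite.symm d)
  refine ⟨![k ![2,0,0], k ![0,2,0], k ![0,0,2], k ![1,1,0], k ![1,0,1], k ![0,1,1]], ?_⟩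
  intro v
  rw [hF, isForm_sum_eq hP, e]
  repeat rw [Finset.sum_insert (by decide)]
  rw [Finset.sum_singleton]
  simp [k]
  ring

lemma IsForm.coeff4 {F : (Fin 3 → ℝ) → ℝ} (h : IsForm 4 F) :
    ∃ a1 a2 a3 a4 a5 a6 a7 a8 a9 a10 a11 a12 a13 a14 a15 : ℝ, ∀ x y z, F ![x,y,z] = 
      a1 * x ^ 4 + x ^ 3 * (a2 * y + a3 * z) + x ^ 2 * (a4 * y ^ 2 + a5 * y * z + a6 * z ^ 2)
      + x * (a7 * y ^ 3 + a8 * y ^ 2 * z + a9 * y * z ^ 2 + a10 * z ^ 3)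
      + (a11 * y ^ 4 + a12 * y ^ 3 * z + a13 * y ^ 2 * z ^ 2 + a14 * y * z ^ 3 + a15 * z ^ 4) := by
  obtain ⟨P, hP, hF⟩ := h
  have e : Finset.Nat.antidiagonalTuple 3 4 =
    {![4,0,0], ![3,1,0], ![3,0,1], ![2,2,0], ![2,1,1], ![2,0,2], ![1,3,0], ![1,2,1], ![1,1,2],
     ![1,0,3], ![0,4,0], ![0,3,1], ![0,2,2], ![0,1,3], ![0,0,4]} := by decide
  let k : (Fin 3 → ℕ) → ℝ := fun d => P.coeff (Finsupp.equivFunOnFinite.symm d)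
  refine ⟨k ![4,0,0], k ![3,1,0], k ![3,0,1], k ![2,2,0], k ![2,1,1], k ![2,0,2], k ![1,3,0],
     k ![1,2,1], k ![1,1,2], k ![1,0,3], k ![0,4,0], k ![0,3,1], k ![0,2,2], k ![0,1,3],
     k ![0,0,4], ?_⟩
  intro x y z
  rw [hF, isForm_sum_eq hP, e]
  repeat rw [Finset.sum_insert (by decide)]
  rw [Finset.sum_singleton]
  simp [k]
  ring

lemma isHomogeneous_quad (c : Fin 6 → ℝ) :
    (C (c 0) * X 0 ^ 2 + C (c 1) * X 1 ^ 2 + C (c 2) * X 2 ^ 2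
      + C (c 3) * (X 0 * X 1) + C (c 4) * (X 0 * X 2) + C (c 5) * (X 1 * X 2) :
      MvPolynomial (Fin 3) ℝ).IsHomogeneous 2 := by
  have h : ∀ (r : ℝ) (i j : Fin 3),
      (C r * (X i * X j) : MvPolynomial (Fin 3) ℝ).IsHomogeneous 2 := fun r i j =>
    ((isHomogeneous_X ℝ i).mul (isHomogeneous_X ℝ j)).C_mul r
  simp only [pow_two]
  exact (((((h _ _ _).add (h _ _ _)).add (h _ _ _)).add (h _ _ _)).add (h _ _ _)).add (h _ _ _)

lemma isForm_quad (c : Fin 6 → ℝ) : IsForm 2 (fun v => c 0 * v 0 ^ 2 + c 1 * v 1 ^ 2 + c 2 * v 2 ^ 2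
      + c 3 * (v 0 * v 1) + c 4 * (v 0 * v 2) + c 5 * (v 1 * v 2)) :=
  ⟨_, isHomogeneous_quad c, fun v => by simp⟩

/-- `F` dominates the square of a nonzero quadratic form. -/
def Dom (F : (Fin 3 → ℝ) → ℝ) : Prop :=
  ∃ q, IsForm 2 q ∧ (∃ v, q v ≠ 0) ∧ ∀ v, q v ^ 2 ≤ F v

lemma Dom.of_comp {F : (Fin 3 → ℝ) → ℝ} (A : Matrix (Fin 3) (Fin 3) ℝ) (hA : A.det ≠ 0)
    (h : Dom (fun v => F (A.mulVec v))) : Dom F := by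
  obtain ⟨q, hq, ⟨v, hv⟩, hle⟩ := h
  have hu : IsUnit A.det := isUnit_iff_ne_zero.2 hA
  refine ⟨fun v => q (A⁻¹.mulVec v), hq.comp _, ⟨A.mulVec v, ?_⟩, fun w => ?_⟩
  · simpa [Matrix.mulVec_mulVec, Matrix.nonsing_inv_mul A hu] using hv
  · have := hle (A⁻¹.mulVec w)
    simpa [Matrix.mulVec_mulVec, Matrix.mul_nonsing_inv A hu] using this


/-- The vector of degree two monomials. -/
def mon (v : Fin 3 → ℝ) : Fin 6 → ℝ :=
  ![v 0 ^ 2, v 1 ^ 2, v 2 ^ 2, v 0 * v 1, v 0 * v 2, v 1 * v 2]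

lemma dot_mon (c : Fin 6 → ℝ) (v : Fin 3 → ℝ) :
    c ⬝ᵥ mon v = c 0 * v 0 ^ 2 + c 1 * v 1 ^ 2 + c 2 * v 2 ^ 2
      + c 3 * (v 0 * v 1) + c 4 * (v 0 * v 2) + c 5 * (v 1 * v 2) := by
  simp [mon, dotProduct, Fin.sum_univ_six]

lemma abs_coef_le (c : Fin 6 → ℝ) (M : ℝ)
    (h1 : |c ⬝ᵥ mon ![1,0,0]| ≤ M) (h2 : |c ⬝ᵥ mon ![0,1,0]| ≤ M) (h3 : |c ⬝ᵥ mon ![0,0,1]| ≤ M)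
    (h4 : |c ⬝ᵥ mon ![1,1,0]| ≤ M) (h5 : |c ⬝ᵥ mon ![1,0,1]| ≤ M) (h6 : |c ⬝ᵥ mon ![0,1,1]| ≤ M)
    (j : Fin 6) : -(3 * M) ≤ c j ∧ c j ≤ 3 * M := by
  simp [dot_mon, abs_le] at h1 h2 h3 h4 h5 h6
  fin_cases j <;> constructor <;> simp <;> linarith

open scoped MatrixOrder Matrix.Norms.L2Operator in
lemma merge_rows (B : Matrix (Fin 6) (Fin 6) ℝ) (c : Fin 6 → ℝ) :
    ∃ D : Matrix (Fin 6) (Fin 6) ℝ, ∀ w : Fin 6 → ℝ,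
      ∑ i, (D i ⬝ᵥ w) ^ 2 = ∑ i, (B i ⬝ᵥ w) ^ 2 + (c ⬝ᵥ w) ^ 2 := by
  have h : (B.conjTranspose * B + Matrix.vecMulVec c (star c)).PosSemidef :=
    (Matrix.posSemidef_conjTranspose_mul_self B).add (Matrix.posSemidef_vecMulVec_self_star c)
  obtain ⟨D, hD⟩ := CStarAlgebra.nonneg_iff_eq_star_mul_self.mp h.nonneg
  refine ⟨D, fun w => ?_⟩
  have key : ∀ E : Matrix (Fin 6) (Fin 6) ℝ,
      w ⬝ᵥ (E.conjTranspose * E).mulVec w = ∑ i, (E i ⬝ᵥ w) ^ 2 := by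
    intro E
    rw [← Matrix.mulVec_mulVec, Matrix.dotProduct_mulVec, Matrix.conjTranspose_eq_transpose_of_trivial,
      Matrix.vecMul_transpose]
    simp [dotProduct, Matrix.mulVec, pow_two]
  have h2 : w ⬝ᵥ (Matrix.vecMulVec c (star c)).mulVec w = (c ⬝ᵥ w) ^ 2 := by
    rw [Matrix.vecMulVec_mulVec]
    simp [dotProduct_comm w c, pow_two]
  rw [← key D, ← key B, ← h2, ← dotProduct_add, ← Matrix.add_mulVec, hD]
  rfl

lemma sos_of_dom (key : ∀ F : (Fin 3 → ℝ) → ℝ, IsForm 4 F → (∀ v, 0 ≤ F v) → (∃ v, F v ≠ 0) → Dom F)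
    (p : MvPolynomial (Fin 3) ℝ) (hhom : p.IsHomogeneous 4)
    (hpos : ∀ x : Fin 3 → ℝ, 0 ≤ MvPolynomial.eval x p) :
    ∃ (m : ℕ) (q : Fin m → MvPolynomial (Fin 3) ℝ),
      (∀ i, (q i).IsHomogeneous 2) ∧ p = ∑ i, (q i) ^ 2 := by
  let K : Set (Fin 6 → Fin 6 → ℝ) := {B | ∀ v, ∑ i, (B i ⬝ᵥ mon v) ^ 2 ≤ eval v p}
  have hclosed : IsClosed K := by
    simp only [K, Set.ofPred_forall]
    refine isClosed_iInter fun v => isClosed_le ?_ continuous_const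
    simp only [dotProduct]
    fun_prop
  let S : ℝ := eval ![1,0,0] p + eval ![0,1,0] p + eval ![0,0,1] p + eval ![1,1,0] p
    + eval ![1,0,1] p + eval ![0,1,1] p
  have hS1 := hpos ![1,0,0]
  have hS2 := hpos ![0,1,0]
  have hS3 := hpos ![0,0,1]
  have hS4 := hpos ![1,1,0]
  have hS5 := hpos ![1,0,1]
  have hS6 := hpos ![0,1,1]
  have hbd : K ⊆ Set.Icc (fun _ _ => -(3 * (1 + S))) (fun _ _ => 3 * (1 + S)) := by
    intro B hB
    have hb : ∀ i v, eval v p ≤ S → |B i ⬝ᵥ mon v| ≤ 1 + S := by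
      intro i v hv
      have h1 := hB v
      have h2 : (B i ⬝ᵥ mon v) ^ 2 ≤ ∑ i, (B i ⬝ᵥ mon v) ^ 2 :=
        Finset.single_le_sum (f := fun i => (B i ⬝ᵥ mon v) ^ 2) (fun _ _ => sq_nonneg _)
          (Finset.mem_univ i)
      have h3 := hpos v
      apply abs_le_of_sq_le_sq _ (by linarith)
      nlinarith
    have hc : ∀ i j, -(3 * (1 + S)) ≤ B i j ∧ B i j ≤ 3 * (1 + S) := by
      intro i j
      apply abs_coef_le <;> apply hb <;> simp only [S] <;> linarith
    exact ⟨fun i j => (hc i j).1, fun i j => (hc i j).2⟩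
  have hcomp : IsCompact K := isCompact_Icc.of_isClosed_subset hclosed hbd
  have hne : K.Nonempty := ⟨0, fun v => by simpa using hpos v⟩
  -- the trace functional, written as a sum of values on the standard basis
  let L : (Fin 6 → Fin 6 → ℝ) → ℝ := fun B => ∑ j, ∑ i, (B i ⬝ᵥ Pi.single j 1) ^ 2
  have hL : Continuous L := by
    simp only [L, dotProduct]
    fun_prop
  obtain ⟨B, hBK, hmax⟩ := hcomp.exists_isMaxOn hne hL.continuousOn
  let q : Fin 6 → MvPolynomial (Fin 3) ℝ := fun i =>
    C (B i 0) * X 0 ^ 2 + C (B i 1) * X 1 ^ 2 + C (B i 2) * X 2 ^ 2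
      + C (B i 3) * (X 0 * X 1) + C (B i 4) * (X 0 * X 2) + C (B i 5) * (X 1 * X 2)
  have hq : ∀ i, (q i).IsHomogeneous 2 := fun i => isHomogeneous_quad (B i)
  have hqe : ∀ i v, eval v (q i) = B i ⬝ᵥ mon v := by
    intro i v
    simp [q, dot_mon]
  have hqs : (∑ i, (q i) ^ 2).IsHomogeneous 4 :=
    IsHomogeneous.sum _ _ _ fun i _ => (hq i).pow 2
  refine ⟨6, q, hq, ?_⟩
  refine hhom.funext hqs fun v => ?_
  by_contra hv
  obtain ⟨r, hr, ⟨u, hu⟩, hle⟩ := key (fun v => eval v (p - ∑ i, (q i) ^ 2))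
    ⟨_, hhom.sub hqs, fun _ => rfl⟩
    (fun v => by simpa [hqe] using hBK v) ⟨v, by simpa [sub_eq_zero] using hv⟩
  obtain ⟨c, hc⟩ := hr.coeff2
  simp only [← dot_mon] at hc
  obtain ⟨D, hD⟩ := merge_rows B c
  have hDK : (D : Fin 6 → Fin 6 → ℝ) ∈ K := by
    intro v
    have h1 := hle v
    have h2 := hD (mon v)
    simp only [map_sub, map_sum, map_pow, hqe, hc] at h1
    linarith
  have h3 : L D ≤ L B := hmax hDK
  have h4 : L D = L B + ∑ j, c j ^ 2 := by
    simp only [L]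
    rw [← Finset.sum_add_distrib]
    refine Finset.sum_congr rfl fun j _ => ?_
    rw [hD]
    simp
  have h5 : ∑ j, c j ^ 2 ≤ 0 := by linarith
  have h6 : ∀ j, c j = 0 := by
    intro j
    have h7 : c j ^ 2 ≤ ∑ j, c j ^ 2 :=
        Finset.single_le_sum (f := fun i => (c i) ^ 2) (fun _ _ => sq_nonneg _)
          (Finset.mem_univ j)
    have : c j ^ 2 = 0 := le_antisymm (h7.trans h5) (sq_nonneg _)
    simpa using this
  apply hu
  rw [hc, dot_mon]
  simp [h6]

/-- Constructor with explicit coefficients. -/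
lemma Dom.mk' {F : (Fin 3 → ℝ) → ℝ} (c : Fin 6 → ℝ) (j : Fin 6) (h0 : c j ≠ 0)
    (h : ∀ x y z, (c 0 * x ^ 2 + c 1 * y ^ 2 + c 2 * z ^ 2
      + c 3 * (x * y) + c 4 * (x * z) + c 5 * (y * z)) ^ 2 ≤ F ![x, y, z]) : Dom F := by
  refine ⟨_, isForm_quad c, ?_, fun v => ?_⟩
  · by_contra! hcon
    simp only [← dot_mon] at hcon
    have := abs_coef_le c 0 (by simp [hcon]) (by simp [hcon]) (by simp [hcon]) (by simp [hcon])
      (by simp [hcon]) (by simp [hcon]) j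
    apply h0
    linarith
  have e : v = ![v 0, v 1, v 2] := by ext i; fin_cases i <;> rfl
  have := h (v 0) (v 1) (v 2)
  rwa [← e] at this

lemma lin_zero {c1 c2 c3 c4 : ℝ}
    (h : ∀ t : ℝ, 0 ≤ c1 * t + c2 * t ^ 2 + c3 * t ^ 3 + c4 * t ^ 4) : c1 = 0 := by
  have hd : HasDerivAt (fun t : ℝ => c1 * t + c2 * t ^ 2 + c3 * t ^ 3 + c4 * t ^ 4) c1 0 := by
    have h1 := (((((hasDerivAt_id (0 : ℝ)).const_mul c1).add
      ((hasDerivAt_pow 2 (0 : ℝ)).const_mul c2)).add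
      ((hasDerivAt_pow 3 (0 : ℝ)).const_mul c3)).add ((hasDerivAt_pow 4 (0 : ℝ)).const_mul c4))
    exact h1.congr_deriv (by norm_num)
  refine IsLocalMin.hasDerivAt_eq_zero ?_ hd
  refine Filter.Eventually.of_forall fun t => ?_
  simpa using h t

lemma nonneg_of_punctured {φ : ℝ → ℝ} (hc : Continuous φ) (h : ∀ t, t ≠ 0 → 0 ≤ φ t) :
    0 ≤ φ 0 := by
  have h1 : Filter.Tendsto φ (nhdsWithin 0 {0}ᶜ) (nhds (φ 0)) :=
    (hc.tendsto 0).mono_left nhdsWithin_le_nhds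
  refine ge_of_tendsto h1 ?_
  filter_upwards [self_mem_nhdsWithin] with t ht
  exact h t ht

lemma disc_le {f g h : ℝ} (H : ∀ x : ℝ, 0 ≤ x ^ 2 * f + x * g + h) : g ^ 2 ≤ 4 * f * h := by
  have := discrim_le_zero (a := f) (b := g) (c := h) (fun x => by have := H x; nlinarith)
  unfold discrim at this
  linarith

lemma pos_bound {n : ℕ} [NeZero n] (m : ℕ) (hm : m ≠ 0) (G : (Fin n → ℝ) → ℝ) (hc : Continuous G)
    (hh : ∀ (t : ℝ) v, G (t • v) = t ^ (2 * m) * G v) (hp : ∀ v, v ≠ 0 → 0 < G v) :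
    ∃ ε > 0, ∀ v, ε * (∑ i, v i ^ 2) ^ m ≤ G v := by
  let S : Set (Fin n → ℝ) := {v | ∑ i, v i ^ 2 = 1}
  have hS : IsCompact S := by
    refine (isCompact_Icc (a := fun _ : Fin n => (-1 : ℝ)) (b := fun _ => 1)).of_isClosed_subset
      (isClosed_eq (by fun_prop) continuous_const) ?_
    intro v hv
    have : ∀ i, |v i| ≤ 1 := by
      intro i
      apply abs_le_of_sq_le_sq _ zero_le_one
      rw [one_pow, ← (show ∑ i, v i ^ 2 = 1 from hv)]
      exact Finset.single_le_sum (f := fun i => v i ^ 2) (fun _ _ => sq_nonneg _)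
        (Finset.mem_univ i)
    exact ⟨fun i => (abs_le.1 (this i)).1, fun i => (abs_le.1 (this i)).2⟩
  have hne : S.Nonempty := ⟨Pi.single 0 1, by
    simp [S, Pi.single_apply]⟩
  obtain ⟨u, hu, hmin⟩ := hS.exists_isMinOn hne hc.continuousOn
  refine ⟨G u, hp u ?_, fun v => ?_⟩
  · rintro rfl
    simp [S] at hu
  · by_cases hv : v = 0
    · subst hv
      have := hh 0 0
      simp [hm] at this
      simp [hm, this]
    · have hN : 0 < ∑ i, v i ^ 2 := by
        obtain ⟨i, hi⟩ := Function.ne_iff.1 hv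
        refine Finset.sum_pos' (fun _ _ => sq_nonneg _) ⟨i, Finset.mem_univ i, ?_⟩
        have : v i ≠ 0 := hi
        positivity
      set N := ∑ i, v i ^ 2 with hNdef
      have hw : (Real.sqrt N)⁻¹ • v ∈ S := by
        simp only [S, Set.mem_ofPred_eq, Pi.smul_apply, smul_eq_mul, mul_pow, ← Finset.mul_sum]
        rw [← hNdef, inv_pow, Real.sq_sqrt hN.le, inv_mul_cancel₀ hN.ne']
      have h1 : G u ≤ G ((Real.sqrt N)⁻¹ • v) := hmin hw
      rw [hh, pow_mul, inv_pow, Real.sq_sqrt hN.le, inv_pow] at h1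
      have hNm : 0 < N ^ m := by positivity
      calc G u * N ^ m ≤ ((N ^ m)⁻¹ * G v) * N ^ m := by gcongr
        _ = G v := by field_simp

lemma pos_bound2 (m : ℕ) (hm : m ≠ 0) (G : ℝ → ℝ → ℝ)
    (hc : Continuous fun v : Fin 2 → ℝ => G (v 0) (v 1))
    (hh : ∀ t y z : ℝ, G (t * y) (t * z) = t ^ (2 * m) * G y z)
    (hp : ∀ y z, (y ≠ 0 ∨ z ≠ 0) → 0 < G y z) :
    ∃ ε > 0, ∀ y z, ε * (y ^ 2 + z ^ 2) ^ m ≤ G y z := by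
  obtain ⟨ε, hε, h⟩ := pos_bound (n := 2) m hm (fun v => G (v 0) (v 1)) hc
    (fun t v => hh t _ _) (fun v hv => hp _ _ (by
      by_contra! hcon
      apply hv
      ext i
      fin_cases i
      · exact hcon.1
      · exact hcon.2))
  exact ⟨ε, hε, fun y z => by simpa [Fin.sum_univ_two] using h ![y, z]⟩

/-- Nonzero nonnegative ternary quartics. -/
structure Good (F : (Fin 3 → ℝ) → ℝ) : Prop where
  form : IsForm 4 F
  nonneg : ∀ v, 0 ≤ F v
  ne : ∃ v, F v ≠ 0

lemma Good.comp {F : (Fin 3 → ℝ) → ℝ} (h : Good F) (A : Matrix (Fin 3) (Fin 3) ℝ)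
    (hA : A.det ≠ 0) : Good (fun v => F (A.mulVec v)) := by
  refine ⟨h.form.comp A, fun v => h.nonneg _, ?_⟩
  obtain ⟨v, hv⟩ := h.ne
  have hu : IsUnit A.det := isUnit_iff_ne_zero.2 hA
  exact ⟨A⁻¹.mulVec v, by simpa [Matrix.mulVec_mulVec, Matrix.mul_nonsing_inv A hu] using hv⟩

lemma vec_eta (v : Fin 3 → ℝ) : v = ![v 0, v 1, v 2] := by
  ext i; fin_cases i <;> rfl

lemma Good.ne' {F : (Fin 3 → ℝ) → ℝ} (h : Good F) : ∃ x y z, F ![x, y, z] ≠ 0 := by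
  obtain ⟨v, hv⟩ := h.ne
  exact ⟨v 0, v 1, v 2, by rwa [← vec_eta]⟩

lemma Good.normal {F : (Fin 3 → ℝ) → ℝ} (h : Good F) (h0 : F ![1, 0, 0] = 0) :
    ∃ a b c g1 g2 g3 g4 h1 h2 h3 h4 h5 : ℝ, ∀ x y z, F ![x, y, z] =
      x ^ 2 * (a * y ^ 2 + b * y * z + c * z ^ 2)
      + x * (g1 * y ^ 3 + g2 * y ^ 2 * z + g3 * y * z ^ 2 + g4 * z ^ 3)
      + (h1 * y ^ 4 + h2 * y ^ 3 * z + h3 * y ^ 2 * z ^ 2 + h4 * y * z ^ 3 + h5 * z ^ 4) := by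
  obtain ⟨a1, a2, a3, a4, a5, a6, a7, a8, a9, a10, a11, a12, a13, a14, a15, hF⟩ := h.form.coeff4
  have e1 : a1 = 0 := by
    have := hF 1 0 0
    rw [h0] at this
    linarith
  subst e1
  have e2 : a2 = 0 := lin_zero (c2 := a4) (c3 := a7) (c4 := a11) fun t => by
    have h1 := hF 1 t 0
    have h2 := h.nonneg ![1, t, 0]
    rw [h1] at h2
    ring_nf at h2 ⊢
    exact h2
  have e3 : a3 = 0 := lin_zero (c2 := a6) (c3 := a10) (c4 := a15) fun t => by
    have h1 := hF 1 0 t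
    have h2 := h.nonneg ![1, 0, t]
    rw [h1] at h2
    ring_nf at h2 ⊢
    exact h2
  subst e2 e3
  exact ⟨a4, a5, a6, a7, a8, a9, a10, a11, a12, a13, a14, a15, fun x y z => by rw [hF]; ring⟩

/-- Binary quartic with a zero at `(0,1)`. -/
lemma dom_binary0 {F : (Fin 3 → ℝ) → ℝ} (hF : Good F) {h1 h2 h3 h4 h5 : ℝ}
    (e : ∀ x y z, F ![x, y, z] =
      h1 * y ^ 4 + h2 * y ^ 3 * z + h3 * y ^ 2 * z ^ 2 + h4 * y * z ^ 3 + h5 * z ^ 4)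
    (h0 : F ![0, 0, 1] = 0) : Dom F := by
  have e5 : h5 = 0 := by
    have := e 0 0 1
    rw [h0] at this
    linarith
  subst e5
  have e4 : h4 = 0 := lin_zero (c2 := h3) (c3 := h2) (c4 := h1) fun t => by
    have h2 := hF.nonneg ![0, t, 1]
    rw [e] at h2
    ring_nf at h2 ⊢
    exact h2
  subst e4
  have hd : h2 ^ 2 ≤ 4 * h3 * h1 := disc_le fun z => by
    have h2 := hF.nonneg ![0, 1, z]
    rw [e] at h2
    ring_nf at h2 ⊢
    exact h2
  have hh1 : 0 ≤ h1 := by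
    have h2 := hF.nonneg ![0, 1, 0]
    rw [e] at h2
    linarith
  have hh3 : 0 ≤ h3 := by
    by_contra! hneg
    have : h1 = 0 := by nlinarith [sq_nonneg h2]
    subst this
    have : h2 = 0 := by nlinarith
    subst this
    have h2 := hF.nonneg ![0, 1, 1]
    rw [e] at h2
    linarith
  rcases hh3.lt_or_eq with hpos | hz
  · have hs : 0 < Real.sqrt h3 := Real.sqrt_pos.2 hpos
    have hs2 : Real.sqrt h3 ^ 2 = h3 := Real.sq_sqrt hpos.le
    set s := Real.sqrt h3
    refine Dom.mk' ![0, h2 / (2 * s), 0, 0, 0, s] 5 ?_ ?_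
    · simpa using hs.ne'
    · intro x y z
      rw [e]
      simp
      have : h2 ^ 2 / (4 * h3) ≤ h1 := by
        rw [div_le_iff₀ (by positivity)]
        linarith
      have e2 : (h2 / (2 * s) * y ^ 2 + s * (y * z)) ^ 2 =
        h2 ^ 2 / (4 * h3) * y ^ 4 + h2 * y ^ 3 * z + h3 * y ^ 2 * z ^ 2 := by
        rw [← hs2]
        field_simp
        ring
      rw [e2]
      have : h2 ^ 2 / (4 * h3) * y ^ 4 ≤ h1 * y ^ 4 := by gcongr
      linarith
  · have hz := hz.symm
    subst hz
    have : h2 = 0 := by nlinarith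
    subst this
    have hne : h1 ≠ 0 := by
      rintro rfl
      obtain ⟨x, y, z, hv⟩ := hF.ne'
      rw [e] at hv
      apply hv
      ring
    have hp : 0 < h1 := lt_of_le_of_ne hh1 (Ne.symm hne)
    refine Dom.mk' ![0, Real.sqrt h1, 0, 0, 0, 0] 1 ?_ ?_
    · simp [Real.sqrt_ne_zero'.2 hp]
    · intro x y z
      rw [e]
      simp
      rw [mul_pow, Real.sq_sqrt hh1]
      linarith

lemma mulVec3 (a b c d e f g h i x y z : ℝ) :
    (!![a, b, c; d, e, f; g, h, i] : Matrix (Fin 3) (Fin 3) ℝ).mulVec ![x, y, z] =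
      ![a * x + b * y + c * z, d * x + e * y + f * z, g * x + h * y + i * z] := by
  ext k
  fin_cases k <;> simp [Matrix.mulVec, dotProduct, Fin.sum_univ_three]

lemma det3 (a b c d e f g h i : ℝ) :
    (!![a, b, c; d, e, f; g, h, i] : Matrix (Fin 3) (Fin 3) ℝ).det =
      a * e * i - a * f * h - b * d * i + b * f * g + c * d * h - c * e * g := by
  simp [Matrix.det_fin_three]

/-- A linear change of `y, z` moving `(0, 1)` to `(y1, z1)`. -/
lemma exists_move_yz {y1 z1 : ℝ} (h : y1 ≠ 0 ∨ z1 ≠ 0) :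
    ∃ p r : ℝ, (!![1, 0, 0; 0, p, y1; 0, r, z1] : Matrix (Fin 3) (Fin 3) ℝ).det ≠ 0 := by
  rcases h with h | h
  · exact ⟨0, 1, by rw [det3]; simpa using h⟩
  · exact ⟨1, 0, by rw [det3]; simpa using h⟩

lemma dom_binary {F : (Fin 3 → ℝ) → ℝ} (hF : Good F) {h1 h2 h3 h4 h5 : ℝ}
    (e : ∀ x y z, F ![x, y, z] =
      h1 * y ^ 4 + h2 * y ^ 3 * z + h3 * y ^ 2 * z ^ 2 + h4 * y * z ^ 3 + h5 * z ^ 4) : Dom F := by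
  by_cases hz : ∃ y1 z1 : ℝ, (y1 ≠ 0 ∨ z1 ≠ 0) ∧ F ![0, y1, z1] = 0
  · obtain ⟨y1, z1, hne, h0⟩ := hz
    obtain ⟨p, r, hdet⟩ := exists_move_yz hne
    refine Dom.of_comp _ hdet (dom_binary0 (hF.comp _ hdet)
      (h1 := h1 * p ^ 4 + h2 * p ^ 3 * r + h3 * p ^ 2 * r ^ 2 + h4 * p * r ^ 3 + h5 * r ^ 4)
      (h2 := h1 * 4 * p ^ 3 * y1 + h2 * (3 * p ^ 2 * y1 * r + p ^ 3 * z1)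
        + h3 * (2 * p * y1 * r ^ 2 + 2 * p ^ 2 * r * z1) + h4 * (y1 * r ^ 3 + 3 * p * r ^ 2 * z1)
        + h5 * 4 * r ^ 3 * z1)
      (h3 := h1 * 6 * p ^ 2 * y1 ^ 2 + h2 * (3 * p * y1 ^ 2 * r + 3 * p ^ 2 * y1 * z1)
        + h3 * (y1 ^ 2 * r ^ 2 + 4 * p * y1 * r * z1 + p ^ 2 * z1 ^ 2)
        + h4 * (3 * p * r * z1 ^ 2 + 3 * y1 * r ^ 2 * z1)
        + h5 * 6 * r ^ 2 * z1 ^ 2)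
      (h4 := h1 * 4 * p * y1 ^ 3 + h2 * (y1 ^ 3 * r + 3 * p * y1 ^ 2 * z1)
        + h3 * (2 * y1 ^ 2 * r * z1 + 2 * p * y1 * z1 ^ 2) + h4 * (p * z1 ^ 3 + 3 * y1 * r * z1 ^ 2)
        + h5 * 4 * r * z1 ^ 3)
      (h5 := h1 * y1 ^ 4 + h2 * y1 ^ 3 * z1 + h3 * y1 ^ 2 * z1 ^ 2 + h4 * y1 * z1 ^ 3 + h5 * z1 ^ 4)
      ?_ ?_)
    · intro x y z
      simp only [mulVec3]
      rw [e]
      ring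
    · simp only [mulVec3]
      simpa using h0
  · push Not at hz
    obtain ⟨ε, hε, hb⟩ := pos_bound2 2 two_ne_zero (fun y z => F ![0, y, z])
      (by simp only [e]; fun_prop) (fun t y z => by simp only [e]; ring)
      (fun y z h => lt_of_le_of_ne (hF.nonneg _) (Ne.symm (hz y z h)))
    refine Dom.mk' ![0, Real.sqrt ε, Real.sqrt ε, 0, 0, 0] 1 ?_ ?_
    · simpa using (Real.sqrt_pos.2 hε).ne'
    · intro x y z
      have := hb y z
      simp only [e] at this ⊢
      simp
      refine le_trans (le_of_eq ?_) this
      rw [← mul_add, mul_pow, Real.sq_sqrt hε.le]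

lemma dom_A0 {F : (Fin 3 → ℝ) → ℝ} (hF : Good F) (h0 : F ![1, 0, 0] = 0)
    {g0 k0 : ℝ} (hl : ∀ x, F ![x, 0, 1] = g0 * x + k0) : Dom F := by
  obtain ⟨a, b, c, g1, g2, g3, g4, h1, h2, h3, h4, h5, e⟩ := hF.normal h0
  have hc : c = 0 := by
    have l0 := hl 0
    have l1 := hl 1
    have l2 := hl (-1)
    rw [e] at l0 l1 l2
    linarith
  subst hc
  have hd : ∀ y z : ℝ, (g1 * y ^ 3 + g2 * y ^ 2 * z + g3 * y * z ^ 2 + g4 * z ^ 3) ^ 2 ≤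
      4 * (a * y ^ 2 + b * y * z + 0 * z ^ 2) *
      (h1 * y ^ 4 + h2 * y ^ 3 * z + h3 * y ^ 2 * z ^ 2 + h4 * y * z ^ 3 + h5 * z ^ 4) := by
    intro y z
    refine disc_le fun x => ?_
    have := hF.nonneg ![x, y, z]
    rwa [e] at this
  have hf : ∀ y z : ℝ, 0 ≤ a * y ^ 2 + b * y * z := by
    intro y z
    -- leading coefficient in `x`
    by_contra! hneg
    set f := a * y ^ 2 + b * y * z with hfdef
    have hdd := hd y z
    set g := g1 * y ^ 3 + g2 * y ^ 2 * z + g3 * y * z ^ 2 + g4 * z ^ 3 with hg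
    set k := h1 * y ^ 4 + h2 * y ^ 3 * z + h3 * y ^ 2 * z ^ 2 + h4 * y * z ^ 3 + h5 * z ^ 4 with hk
    have hx : ∀ x : ℝ, 0 ≤ x ^ 2 * f + x * g + k := by
      intro x
      have := hF.nonneg ![x, y, z]
      rw [e] at this
      simpa [hfdef, hg, hk] using this
    have k0 := hx 0
    have k2 : k = 0 := by nlinarith [sq_nonneg g]
    have k3 : g = 0 := by
      rw [k2] at hdd
      nlinarith
    have := hx 1
    rw [k2, k3] at this
    linarith
  have hb : b = 0 := lin_zero (c2 := a) (c3 := 0) (c4 := 0) fun t => by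
    have := hf t 1
    ring_nf at this ⊢
    linarith
  subst hb
  have ha : 0 ≤ a := by simpa using hf 1 0
  have hg4 : g4 = 0 := by
    have := hd 0 1
    ring_nf at this
    nlinarith
  subst hg4
  rcases ha.lt_or_eq with hpos | hz
  · have hq : ∀ y z : ℝ, 0 ≤ 4 * a * (h1 * y ^ 4 + h2 * y ^ 3 * z + h3 * y ^ 2 * z ^ 2
        + h4 * y * z ^ 3 + h5 * z ^ 4) - (g1 * y ^ 2 + g2 * y * z + g3 * z ^ 2) ^ 2 := by
      have hq1 : ∀ y z : ℝ, y ≠ 0 → 0 ≤ 4 * a * (h1 * y ^ 4 + h2 * y ^ 3 * z + h3 * y ^ 2 * z ^ 2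
        + h4 * y * z ^ 3 + h5 * z ^ 4) - (g1 * y ^ 2 + g2 * y * z + g3 * z ^ 2) ^ 2 := by
        intro y z hy
        have hy2 : 0 < y ^ 2 := by positivity
        refine nonneg_of_mul_nonneg_right (a := y ^ 2) ?_ hy2
        have := hd y z
        linarith
      intro y z
      by_cases hy : y = 0
      · subst hy
        exact nonneg_of_punctured (φ := fun y => 4 * a * (h1 * y ^ 4 + h2 * y ^ 3 * z
          + h3 * y ^ 2 * z ^ 2 + h4 * y * z ^ 3 + h5 * z ^ 4)
          - (g1 * y ^ 2 + g2 * y * z + g3 * z ^ 2) ^ 2) (by fun_prop) (fun t ht => hq1 t z ht)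
      · exact hq1 y z hy
    have hs : 0 < Real.sqrt a := Real.sqrt_pos.2 hpos
    have hs2 : Real.sqrt a ^ 2 = a := Real.sq_sqrt hpos.le
    set s := Real.sqrt a
    refine Dom.mk' ![0, g1 / (2 * s), g3 / (2 * s), s, 0, g2 / (2 * s)] 3 ?_ ?_
    · simpa using hs.ne'
    · intro x y z
      have hqq := hq y z
      rw [e]
      simp
      rw [← sub_nonneg]
      have : 0 ≤ (4 * a * (h1 * y ^ 4 + h2 * y ^ 3 * z + h3 * y ^ 2 * z ^ 2
        + h4 * y * z ^ 3 + h5 * z ^ 4) - (g1 * y ^ 2 + g2 * y * z + g3 * z ^ 2) ^ 2) / (4 * a) := by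
        positivity
      refine le_of_le_of_eq this ?_
      rw [← hs2]
      field_simp
      ring
  · have hz := hz.symm
    subst hz
    refine dom_binary hF (h1 := h1) (h2 := h2) (h3 := h3) (h4 := h4) (h5 := h5) ?_
    intro x y z
    rw [e]
    have : g1 * y ^ 3 + g2 * y ^ 2 * z + g3 * y * z ^ 2 + 0 * z ^ 3 = 0 := by
      have := hd y z
      nlinarith
    rw [this]
    ring

lemma dom_A {F : (Fin 3 → ℝ) → ℝ} (hF : Good F) (h0 : F ![1, 0, 0] = 0) {y1 z1 : ℝ}
    (hne : y1 ≠ 0 ∨ z1 ≠ 0) {g0 k0 : ℝ} (hl : ∀ x, F ![x, y1, z1] = g0 * x + k0) : Dom F := by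
  obtain ⟨p, r, hdet⟩ := exists_move_yz hne
  refine Dom.of_comp _ hdet (dom_A0 (hF.comp _ hdet) (g0 := g0) (k0 := k0) ?_ ?_)
  · simp only [mulVec3]
    simpa using h0
  · intro x
    simp only [mulVec3]
    rw [← hl]
    congr 1
    simp

lemma quad_div {A B D y1 z1 : ℝ} (hne : y1 ≠ 0 ∨ z1 ≠ 0)
    (h0 : A * y1 ^ 2 + B * y1 * z1 + D * z1 ^ 2 = 0) :
    ∃ m1 m2 : ℝ, ∀ y z : ℝ, A * y ^ 2 + B * y * z + D * z ^ 2 =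
      (z1 * y - y1 * z) * (m1 * y + m2 * z) := by
  rcases hne with h | h
  · refine ⟨(-(z1 * D / y1) - B) / y1, -D / y1, fun y z => ?_⟩
    have hA : A = (-(B * y1 * z1) - D * z1 ^ 2) / y1 ^ 2 := by
      rw [eq_div_iff (by positivity)]
      linarith
    rw [hA]
    field_simp
    ring
  · refine ⟨A / z1, (B + y1 * A / z1) / z1, fun y z => ?_⟩
    have hD : D = (-(B * y1 * z1) - A * y1 ^ 2) / z1 ^ 2 := by
      rw [eq_div_iff (by positivity)]
      linarith
    rw [hD]
    field_simp
    ring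

lemma quad_sq {A B D y1 z1 : ℝ} (hne : y1 ≠ 0 ∨ z1 ≠ 0)
    (h0 : A * y1 ^ 2 + B * y1 * z1 + D * z1 ^ 2 = 0)
    (hp : ∀ y z : ℝ, 0 ≤ A * y ^ 2 + B * y * z + D * z ^ 2) :
    ∃ k : ℝ, 0 ≤ k ∧ ∀ y z : ℝ, A * y ^ 2 + B * y * z + D * z ^ 2 = k * (z1 * y - y1 * z) ^ 2 := by
  have hd : B ^ 2 ≤ 4 * A * D := disc_le fun y => by
    have := hp y 1
    linarith
  have e1 : B * y1 + 2 * D * z1 = 0 := by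
    have : (B * y1 + 2 * D * z1) ^ 2 = (B ^ 2 - 4 * A * D) * y1 ^ 2 := by
      linear_combination 4 * D * h0
    nlinarith [sq_nonneg y1, mul_nonneg (sub_nonneg.2 hd) (sq_nonneg y1)]
  have e2 : B * z1 + 2 * A * y1 = 0 := by
    have : (B * z1 + 2 * A * y1) ^ 2 = (B ^ 2 - 4 * A * D) * z1 ^ 2 := by
      linear_combination 4 * A * h0
    nlinarith [sq_nonneg z1, mul_nonneg (sub_nonneg.2 hd) (sq_nonneg z1)]
  rcases hne with h | h
  · refine ⟨D / y1 ^ 2, ?_, fun y z => ?_⟩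
    · have : 0 ≤ D := by simpa using hp 0 1
      positivity
    · have hB : B = -(2 * D * z1) / y1 := by
        rw [eq_div_iff h]; linarith
      have hA : A = -(B * z1) / (2 * y1) := by
        rw [eq_div_iff (by simpa using h)]; linarith
      rw [hA, hB]
      field_simp
      ring
  · refine ⟨A / z1 ^ 2, ?_, fun y z => ?_⟩
    · have : 0 ≤ A := by simpa using hp 1 0
      positivity
    · have hB : B = -(2 * A * y1) / z1 := by
        rw [eq_div_iff h]; linarith
      have hD : D = -(B * y1) / (2 * z1) := by
        rw [eq_div_iff (by simpa using h)]; linarith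
      rw [hD, hB]
      field_simp
      ring

/-- A quadratic polynomial that is nonnegative everywhere has nonnegative leading coefficient. -/
lemma lead_nonneg {f g h : ℝ} (H : ∀ x : ℝ, 0 ≤ x ^ 2 * f + x * g + h) : 0 ≤ f := by
  by_contra! hneg
  have hdd := disc_le H
  have k0 := H 0
  have k2 : h = 0 := by nlinarith [sq_nonneg g]
  have k3 : g = 0 := by
    rw [k2] at hdd
    nlinarith
  have := H 1
  rw [k2, k3] at this
  linarith

lemma quad_le (a b c y z : ℝ) :
    a * y ^ 2 + b * y * z + c * z ^ 2 ≤ (|a| + |b| + |c|) * (y ^ 2 + z ^ 2) := by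
  have h1 := le_abs_self a
  have h2 := le_abs_self b
  have h2' := neg_abs_le b
  have h3 := le_abs_self c
  have ha := abs_nonneg a
  have hb := abs_nonneg b
  have hc := abs_nonneg c
  have e1 : a * y ^ 2 ≤ |a| * y ^ 2 := by gcongr
  have e3 : c * z ^ 2 ≤ |c| * z ^ 2 := by gcongr
  have e2 : b * y * z ≤ |b| * (y ^ 2 + z ^ 2) := by
    have : b * (y * z) ≤ |b| * |y * z| := by rw [← abs_mul]; exact le_abs_self _
    have h4 : |y * z| ≤ y ^ 2 + z ^ 2 := by
      rw [abs_le]; constructor <;> nlinarith [sq_nonneg (y + z), sq_nonneg (y - z)]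
    nlinarith [mul_le_mul_of_nonneg_left h4 hb]
  nlinarith [mul_nonneg ha (sq_nonneg z), mul_nonneg hc (sq_nonneg y)]

lemma exists_center {f g : ℝ} (hf : f ≠ 0) : ∃ t : ℝ, g + 2 * t * f = 0 :=
  ⟨-g / (2 * f), by field_simp; ring⟩

set_option maxHeartbeats 2000000 in
lemma dom_B {F : (Fin 3 → ℝ) → ℝ} (hF : Good F) (h0 : F ![1, 0, 0] = 0) (h0' : F ![0, 1, 0] = 0) :
    Dom F := by
  obtain ⟨a, b, c, g1, g2, g3, g4, h1, h2, h3, h4, h5, e⟩ := hF.normal h0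
  have e1 : h1 = 0 := by
    have := e 0 1 0
    rw [h0'] at this
    linarith
  subst e1
  have e2 : h2 = 0 := lin_zero (c2 := h3) (c3 := h4) (c4 := h5) fun t => by
    have h2 := hF.nonneg ![0, 1, t]
    rw [e] at h2
    ring_nf at h2 ⊢
    exact h2
  subst e2
  have e3 : g1 = 0 := lin_zero (c2 := a) (c3 := 0) (c4 := 0) fun t => by
    have h2 := hF.nonneg ![t, 1, 0]
    rw [e] at h2
    ring_nf at h2 ⊢
    exact h2
  subst e3
  by_cases hfz : ∃ y1 z1 : ℝ, (y1 ≠ 0 ∨ z1 ≠ 0) ∧ a * y1 ^ 2 + b * y1 * z1 + c * z1 ^ 2 = 0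
  · obtain ⟨y1, z1, hne, hz⟩ := hfz
    exact dom_A hF h0 hne (fun x => by rw [e, hz, mul_zero, zero_add, mul_comm x])
      (g0 := 0 * y1 ^ 3 + g2 * y1 ^ 2 * z1 + g3 * y1 * z1 ^ 2 + g4 * z1 ^ 3)
      (k0 := 0 * y1 ^ 4 + 0 * y1 ^ 3 * z1 + h3 * y1 ^ 2 * z1 ^ 2 + h4 * y1 * z1 ^ 3 + h5 * z1 ^ 4)
  push Not at hfz
  have hx : ∀ y z x : ℝ, 0 ≤ x ^ 2 * (a * y ^ 2 + b * y * z + c * z ^ 2)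
      + x * (z * (g2 * y ^ 2 + g3 * y * z + g4 * z ^ 2))
      + z ^ 2 * (h3 * y ^ 2 + h4 * y * z + h5 * z ^ 2) := by
    intro y z x
    have := hF.nonneg ![x, y, z]
    rw [e] at this
    linarith
  have hfpos : ∀ y z : ℝ, (y ≠ 0 ∨ z ≠ 0) → 0 < a * y ^ 2 + b * y * z + c * z ^ 2 :=
    fun y z h => lt_of_le_of_ne (lead_nonneg (hx y z)) (Ne.symm (hfz y z h))
  have hD : ∀ y z : ℝ, 0 ≤ 4 * (a * y ^ 2 + b * y * z + c * z ^ 2)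
      * (h3 * y ^ 2 + h4 * y * z + h5 * z ^ 2) - (g2 * y ^ 2 + g3 * y * z + g4 * z ^ 2) ^ 2 := by
    have hq1 : ∀ y z : ℝ, z ≠ 0 → 0 ≤ 4 * (a * y ^ 2 + b * y * z + c * z ^ 2)
      * (h3 * y ^ 2 + h4 * y * z + h5 * z ^ 2) - (g2 * y ^ 2 + g3 * y * z + g4 * z ^ 2) ^ 2 := by
      intro y z hz
      have hz2 : 0 < z ^ 2 := by positivity
      refine nonneg_of_mul_nonneg_right (a := z ^ 2) ?_ hz2
      have := disc_le (hx y z)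
      linarith
    intro y z
    by_cases hz : z = 0
    · subst hz
      exact nonneg_of_punctured (φ := fun z => 4 * (a * y ^ 2 + b * y * z + c * z ^ 2)
      * (h3 * y ^ 2 + h4 * y * z + h5 * z ^ 2) - (g2 * y ^ 2 + g3 * y * z + g4 * z ^ 2) ^ 2)
       (by fun_prop) (fun t ht => hq1 y t ht)
    · exact hq1 y z hz
  by_cases hDz : ∃ y1 z1 : ℝ, (y1 ≠ 0 ∨ z1 ≠ 0) ∧ 4 * (a * y1 ^ 2 + b * y1 * z1 + c * z1 ^ 2)
      * (h3 * y1 ^ 2 + h4 * y1 * z1 + h5 * z1 ^ 2)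
      - (g2 * y1 ^ 2 + g3 * y1 * z1 + g4 * z1 ^ 2) ^ 2 = 0
  · obtain ⟨y1, z1, hne, hz⟩ := hDz
    have hf1 := hfpos y1 z1 hne
    obtain ⟨α, hα⟩ : ∃ α : ℝ, (g2 * y1 ^ 2 + g3 * y1 * z1 + g4 * z1 ^ 2)
        + 2 * α * (a * y1 ^ 2 + b * y1 * z1 + c * z1 ^ 2) = 0 :=
      exists_center hf1.ne'
    have hdet : (!![1, 0, α; 0, 1, 0; 0, 0, 1] : Matrix (Fin 3) (Fin 3) ℝ).det ≠ 0 := by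
      rw [det3]; norm_num
    refine Dom.of_comp _ hdet ?_
    have e' : ∀ x y z : ℝ, F ((!![1, 0, α; 0, 1, 0; 0, 0, 1] : Matrix (Fin 3) (Fin 3) ℝ).mulVec
        ![x, y, z]) = x ^ 2 * (a * y ^ 2 + b * y * z + c * z ^ 2)
        + x * z * ((g2 + 2 * α * a) * y ^ 2 + (g3 + 2 * α * b) * y * z + (g4 + 2 * α * c) * z ^ 2)
        + z ^ 2 * ((h3 + α * g2 + α ^ 2 * a) * y ^ 2 + (h4 + α * g3 + α ^ 2 * b) * y * z
          + (h5 + α * g4 + α ^ 2 * c) * z ^ 2) := by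
      intro x y z
      rw [mulVec3, e]
      ring
    have hDs : ∀ y z : ℝ, 4 * (a * y ^ 2 + b * y * z + c * z ^ 2)
        * ((h3 + α * g2 + α ^ 2 * a) * y ^ 2 + (h4 + α * g3 + α ^ 2 * b) * y * z
          + (h5 + α * g4 + α ^ 2 * c) * z ^ 2)
        - ((g2 + 2 * α * a) * y ^ 2 + (g3 + 2 * α * b) * y * z + (g4 + 2 * α * c) * z ^ 2) ^ 2
        = 4 * (a * y ^ 2 + b * y * z + c * z ^ 2)
      * (h3 * y ^ 2 + h4 * y * z + h5 * z ^ 2) - (g2 * y ^ 2 + g3 * y * z + g4 * z ^ 2) ^ 2 := by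
      intro y z; ring
    have hG0 : (g2 + 2 * α * a) * y1 ^ 2 + (g3 + 2 * α * b) * y1 * z1
        + (g4 + 2 * α * c) * z1 ^ 2 = 0 := by linarith
    have hH0 : (h3 + α * g2 + α ^ 2 * a) * y1 ^ 2 + (h4 + α * g3 + α ^ 2 * b) * y1 * z1
          + (h5 + α * g4 + α ^ 2 * c) * z1 ^ 2 = 0 := by
      have h := hDs y1 z1
      rw [hz, hG0] at h
      rw [zero_pow two_ne_zero, sub_zero] at h
      rcases mul_eq_zero.1 h with h' | h'
      · linarith
      · exact h'
    have hHp : ∀ y z : ℝ, 0 ≤ (h3 + α * g2 + α ^ 2 * a) * y ^ 2 + (h4 + α * g3 + α ^ 2 * b) * y * z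
          + (h5 + α * g4 + α ^ 2 * c) * z ^ 2 := by
      intro y z
      by_cases hyz : y ≠ 0 ∨ z ≠ 0
      · have hf := hfpos y z hyz
        refine nonneg_of_mul_nonneg_right (a := 4 * (a * y ^ 2 + b * y * z + c * z ^ 2)) ?_
          (by linarith)
        have := hD y z
        rw [← hDs y z] at this
        nlinarith [sq_nonneg ((g2 + 2 * α * a) * y ^ 2 + (g3 + 2 * α * b) * y * z
          + (g4 + 2 * α * c) * z ^ 2)]
      · push Not at hyz
        rw [hyz.1, hyz.2]
        simp
    obtain ⟨k, hk, hH⟩ := quad_sq hne hH0 hHp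
    obtain ⟨m1, m2, hG⟩ := quad_div hne hG0
    have hDk : ∀ y z : ℝ, 0 ≤ (z1 * y - y1 * z) ^ 2 *
        (4 * k * (a * y ^ 2 + b * y * z + c * z ^ 2) - (m1 * y + m2 * z) ^ 2) := by
      intro y z
      have := hD y z
      rw [← hDs y z, hH, hG] at this
      linarith
    have hm : ∀ y z : ℝ,
        0 ≤ 4 * k * (a * y ^ 2 + b * y * z + c * z ^ 2) - (m1 * y + m2 * z) ^ 2 := by
      intro y z
      by_cases hl : z1 * y - y1 * z = 0
      · have hN : 0 < z1 ^ 2 + y1 ^ 2 := by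
          rcases hne with h | h <;> positivity
        have := nonneg_of_punctured (φ := fun t => 4 * k * (a * (y + t * z1) ^ 2
          + b * (y + t * z1) * (z - t * y1) + c * (z - t * y1) ^ 2)
          - (m1 * (y + t * z1) + m2 * (z - t * y1)) ^ 2) (by fun_prop) (fun t ht => by
            refine nonneg_of_mul_nonneg_right (hDk (y + t * z1) (z - t * y1)) ?_
            have : z1 * (y + t * z1) - y1 * (z - t * y1) = t * (z1 ^ 2 + y1 ^ 2) := by
              linear_combination hl
            rw [this]
            positivity)
        simpa using this
      · exact nonneg_of_mul_nonneg_right (hDk y z) (by positivity)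
    simp only [hH, hG] at e'
    rcases hk.lt_or_eq with hkp | hkz
    · have hs : 0 < Real.sqrt k := Real.sqrt_pos.2 hkp
      have hs2 : Real.sqrt k ^ 2 = k := Real.sq_sqrt hkp.le
      set s := Real.sqrt k
      have hle : ∀ x y z : ℝ, (0 * x ^ 2 + 0 * y ^ 2 + -(s * y1) * z ^ 2 + m1 / (2 * s) * (x * y)
          + m2 / (2 * s) * (x * z) + s * z1 * (y * z)) ^ 2 ≤
          F ((!![1, 0, α; 0, 1, 0; 0, 0, 1] : Matrix (Fin 3) (Fin 3) ℝ).mulVec ![x, y, z]) := by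
        intro x y z
        rw [e', ← sub_nonneg]
        have h1 := hm y z
        have : 0 ≤ x ^ 2 * ((4 * k * (a * y ^ 2 + b * y * z + c * z ^ 2)
          - (m1 * y + m2 * z) ^ 2) / (4 * k)) := by positivity
        refine le_of_le_of_eq this ?_
        rw [← hs2]
        field_simp
        ring
      rcases hne with h | h
      · exact Dom.mk' ![0, 0, -(s * y1), m1 / (2 * s), m2 / (2 * s), s * z1] 2
          (by simpa using ⟨hs.ne', h⟩) hle
      · exact Dom.mk' ![0, 0, -(s * y1), m1 / (2 * s), m2 / (2 * s), s * z1] 5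
          (by simpa using ⟨hs.ne', h⟩) hle
    · have hkz := hkz.symm
      subst hkz
      obtain ⟨ε, hε, hb⟩ := pos_bound2 1 one_ne_zero
        (fun y z => a * y ^ 2 + b * y * z + c * z ^ 2)
        (by fun_prop) (fun t y z => by ring) hfpos
      refine Dom.mk' ![0, 0, 0, Real.sqrt ε, 0, 0] 3 ?_ ?_
      · simpa using (Real.sqrt_pos.2 hε).ne'
      · intro x y z
        rw [e']
        have h1 := hm y z
        have h2 : m1 * y + m2 * z = 0 := by nlinarith
        rw [h2]
        simp
        rw [mul_pow, Real.sq_sqrt hε.le]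
        have h3 := hb y z
        have h4 : x ^ 2 * (ε * (y ^ 2 + z ^ 2) ^ 1) ≤
          x ^ 2 * (a * y ^ 2 + b * y * z + c * z ^ 2) := by gcongr
        have : 0 ≤ x ^ 2 * (ε * z ^ 2) := by positivity
        linarith
  · push Not at hDz
    obtain ⟨ε, hε, hb⟩ := pos_bound2 2 two_ne_zero
      (fun y z => 4 * (a * y ^ 2 + b * y * z + c * z ^ 2)
      * (h3 * y ^ 2 + h4 * y * z + h5 * z ^ 2) - (g2 * y ^ 2 + g3 * y * z + g4 * z ^ 2) ^ 2)
      (by fun_prop) (fun t y z => by ring)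
      (fun y z h => lt_of_le_of_ne (hD y z) (Ne.symm (hDz y z h)))
    have ha : 0 < a := by simpa using hfpos 1 0 (by simp)
    have hM : 0 < |a| + |b| + |c| := by positivity
    set M := |a| + |b| + |c| with hMdef
    have hδ : 0 < ε / (4 * M) := by positivity
    refine Dom.mk' ![0, 0, Real.sqrt (ε / (4 * M)), 0, 0, 0] 2 ?_ ?_
    · simpa using (Real.sqrt_pos.2 hδ).ne'
    · intro x y z
      have hnn := hF.nonneg ![x, y, z]
      simp
      rw [mul_pow, Real.sq_sqrt hδ.le]
      by_cases hyz : y ≠ 0 ∨ z ≠ 0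
      · have hN : 0 < y ^ 2 + z ^ 2 := by
          rcases hyz with h | h <;> positivity
        have hf := hfpos y z hyz
        have hfM := quad_le a b c y z
        rw [← hMdef] at hfM
        have hbb := hb y z
        have k1 : 4 * (a * y ^ 2 + b * y * z + c * z ^ 2) * F ![x, y, z] =
          (2 * x * (a * y ^ 2 + b * y * z + c * z ^ 2)
            + z * (g2 * y ^ 2 + g3 * y * z + g4 * z ^ 2)) ^ 2
          + z ^ 2 * (4 * (a * y ^ 2 + b * y * z + c * z ^ 2)
      * (h3 * y ^ 2 + h4 * y * z + h5 * z ^ 2) - (g2 * y ^ 2 + g3 * y * z + g4 * z ^ 2) ^ 2) := by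
          rw [e]; ring
        have k2 : z ^ 2 * (ε * (y ^ 2 + z ^ 2) ^ 2) ≤
            4 * (a * y ^ 2 + b * y * z + c * z ^ 2) * F ![x, y, z] := by
          rw [k1]
          have := mul_le_mul_of_nonneg_left hbb (sq_nonneg z)
          exact this.trans (le_add_of_nonneg_left (sq_nonneg _))
        have k3 : (a * y ^ 2 + b * y * z + c * z ^ 2) * F ![x, y, z] ≤
          (M * (y ^ 2 + z ^ 2)) * F ![x, y, z] := by gcongr
        have k4 : (y ^ 2 + z ^ 2) * (ε * z ^ 2 * (y ^ 2 + z ^ 2)) ≤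
            (y ^ 2 + z ^ 2) * (4 * M * F ![x, y, z]) := by linarith
        have k5 := le_of_mul_le_mul_left k4 hN
        have k6 : ε * z ^ 2 * z ^ 2 ≤ ε * z ^ 2 * (y ^ 2 + z ^ 2) := by
          gcongr
          nlinarith [sq_nonneg y]
        rw [div_mul_eq_mul_div, div_le_iff₀ (by positivity)]
        linarith
      · push Not at hyz
        rw [hyz.2]
        simpa [hyz.2] using hnn

set_option maxHeartbeats 2000000 in
lemma dom_C {F : (Fin 3 → ℝ) → ℝ} (hF : Good F) (h0 : F ![1, 0, 0] = 0) : Dom F := by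
  obtain ⟨a, b, c, g1, g2, g3, g4, h1, h2, h3, h4, h5, e⟩ := hF.normal h0
  by_cases hfz : ∃ y1 z1 : ℝ, (y1 ≠ 0 ∨ z1 ≠ 0) ∧ a * y1 ^ 2 + b * y1 * z1 + c * z1 ^ 2 = 0
  · obtain ⟨y1, z1, hne, hz⟩ := hfz
    exact dom_A hF h0 hne (fun x => by rw [e, hz, mul_zero, zero_add, mul_comm x])
      (g0 := g1 * y1 ^ 3 + g2 * y1 ^ 2 * z1 + g3 * y1 * z1 ^ 2 + g4 * z1 ^ 3)
      (k0 := h1 * y1 ^ 4 + h2 * y1 ^ 3 * z1 + h3 * y1 ^ 2 * z1 ^ 2 + h4 * y1 * z1 ^ 3 + h5 * z1 ^ 4)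
  push Not at hfz
  have hx : ∀ y z x : ℝ, 0 ≤ x ^ 2 * (a * y ^ 2 + b * y * z + c * z ^ 2)
      + x * (g1 * y ^ 3 + g2 * y ^ 2 * z + g3 * y * z ^ 2 + g4 * z ^ 3)
      + (h1 * y ^ 4 + h2 * y ^ 3 * z + h3 * y ^ 2 * z ^ 2 + h4 * y * z ^ 3 + h5 * z ^ 4) := by
    intro y z x
    have := hF.nonneg ![x, y, z]
    rwa [e] at this
  have hfpos : ∀ y z : ℝ, (y ≠ 0 ∨ z ≠ 0) → 0 < a * y ^ 2 + b * y * z + c * z ^ 2 :=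
    fun y z h => lt_of_le_of_ne (lead_nonneg (hx y z)) (Ne.symm (hfz y z h))
  have k1 : ∀ x y z : ℝ, 4 * (a * y ^ 2 + b * y * z + c * z ^ 2) * F ![x, y, z] =
      (2 * x * (a * y ^ 2 + b * y * z + c * z ^ 2)
        + (g1 * y ^ 3 + g2 * y ^ 2 * z + g3 * y * z ^ 2 + g4 * z ^ 3)) ^ 2
      + (4 * (a * y ^ 2 + b * y * z + c * z ^ 2)
      * (h1 * y ^ 4 + h2 * y ^ 3 * z + h3 * y ^ 2 * z ^ 2 + h4 * y * z ^ 3 + h5 * z ^ 4)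
      - (g1 * y ^ 3 + g2 * y ^ 2 * z + g3 * y * z ^ 2 + g4 * z ^ 3) ^ 2) := by
    intro x y z
    rw [e]; ring
  by_cases hDz : ∃ y1 z1 : ℝ, (y1 ≠ 0 ∨ z1 ≠ 0) ∧
      4 * (a * y1 ^ 2 + b * y1 * z1 + c * z1 ^ 2) * (h1 * y1 ^ 4 + h2 * y1 ^ 3 * z1
        + h3 * y1 ^ 2 * z1 ^ 2 + h4 * y1 * z1 ^ 3 + h5 * z1 ^ 4)
      - (g1 * y1 ^ 3 + g2 * y1 ^ 2 * z1 + g3 * y1 * z1 ^ 2 + g4 * z1 ^ 3) ^ 2 = 0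
  · obtain ⟨y1, z1, hne, hz⟩ := hDz
    have hf1 := hfpos y1 z1 hne
    obtain ⟨x1, hx1⟩ := exists_center
      (g := g1 * y1 ^ 3 + g2 * y1 ^ 2 * z1 + g3 * y1 * z1 ^ 2 + g4 * z1 ^ 3) hf1.ne'
    rw [add_comm] at hx1
    have hF1 : F ![x1, y1, z1] = 0 := by
      have h := k1 x1 y1 z1
      rw [hz, hx1] at h
      have h' : 4 * (a * y1 ^ 2 + b * y1 * z1 + c * z1 ^ 2) * F ![x1, y1, z1] = 0 := by linarith
      rcases mul_eq_zero.1 h' with h' | h'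
      · linarith
      · exact h'
    obtain ⟨p, r, hdet⟩ : ∃ p r : ℝ,
        (!![1, x1, 0; 0, y1, p; 0, z1, r] : Matrix (Fin 3) (Fin 3) ℝ).det ≠ 0 := by
      rcases hne with h | h
      · exact ⟨0, 1, by rw [det3]; simpa using h⟩
      · exact ⟨1, 0, by rw [det3]; simpa using h⟩
    refine Dom.of_comp _ hdet (dom_B (hF.comp _ hdet) ?_ ?_)
    · simp only [mulVec3]
      simpa using h0
    · simp only [mulVec3]
      simpa using hF1
  · push Not at hDz
    obtain ⟨ε, hε, hb⟩ := pos_bound2 3 three_ne_zero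
      (fun y z => 4 * (a * y ^ 2 + b * y * z + c * z ^ 2)
      * (h1 * y ^ 4 + h2 * y ^ 3 * z + h3 * y ^ 2 * z ^ 2 + h4 * y * z ^ 3 + h5 * z ^ 4)
      - (g1 * y ^ 3 + g2 * y ^ 2 * z + g3 * y * z ^ 2 + g4 * z ^ 3) ^ 2)
      (by fun_prop) (fun t y z => by ring)
      (fun y z h => lt_of_le_of_ne (sub_nonneg.2 (disc_le (hx y z))) (Ne.symm (hDz y z h)))
    have ha : 0 < a := by simpa using hfpos 1 0 (by simp)
    have hM : 0 < |a| + |b| + |c| := by positivity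
    set M := |a| + |b| + |c| with hMdef
    have hδ : 0 < ε / (4 * M) := by positivity
    refine Dom.mk' ![0, Real.sqrt (ε / (4 * M)), Real.sqrt (ε / (4 * M)), 0, 0, 0] 2 ?_ ?_
    · simpa using (Real.sqrt_pos.2 hδ).ne'
    · intro x y z
      have hnn := hF.nonneg ![x, y, z]
      simp
      rw [← mul_add, mul_pow, Real.sq_sqrt hδ.le]
      by_cases hyz : y ≠ 0 ∨ z ≠ 0
      · have hN : 0 < y ^ 2 + z ^ 2 := by
          rcases hyz with h | h <;> positivity
        have hfM := quad_le a b c y z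
        rw [← hMdef] at hfM
        have hbb := hb y z
        have k2 : ε * (y ^ 2 + z ^ 2) ^ 3 ≤
            4 * (a * y ^ 2 + b * y * z + c * z ^ 2) * F ![x, y, z] := by
          rw [k1]
          exact hbb.trans (le_add_of_nonneg_left (sq_nonneg _))
        have k3 : (a * y ^ 2 + b * y * z + c * z ^ 2) * F ![x, y, z] ≤
          (M * (y ^ 2 + z ^ 2)) * F ![x, y, z] := by gcongr
        have k4 : (y ^ 2 + z ^ 2) * (ε * (y ^ 2 + z ^ 2) ^ 2) ≤
            (y ^ 2 + z ^ 2) * (4 * M * F ![x, y, z]) := by linarith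
        have k5 := le_of_mul_le_mul_left k4 hN
        rw [div_mul_eq_mul_div, div_le_iff₀ (by positivity)]
        linarith
      · push Not at hyz
        simpa [hyz.1, hyz.2] using hnn

lemma dom_of_good {F : (Fin 3 → ℝ) → ℝ} (hF : Good F) : Dom F := by
  by_cases hz : ∃ u, u ≠ 0 ∧ F u = 0
  · obtain ⟨u, hne, h0⟩ := hz
    obtain ⟨p1, p2, p3, r1, r2, r3, hdet⟩ : ∃ p1 p2 p3 r1 r2 r3 : ℝ,
        (!![u 0, p1, r1; u 1, p2, r2; u 2, p3, r3] : Matrix (Fin 3) (Fin 3) ℝ).det ≠ 0 := by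
      obtain ⟨i, hi⟩ := Function.ne_iff.1 hne
      fin_cases i
      · exact ⟨0, 1, 0, 0, 0, 1, by rw [det3]; simpa using hi⟩
      · exact ⟨1, 0, 0, 0, 0, 1, by rw [det3]; simpa using hi⟩
      · exact ⟨1, 0, 0, 0, 1, 0, by rw [det3]; simpa using hi⟩
    refine Dom.of_comp _ hdet (dom_C (hF.comp _ hdet) ?_)
    simp only [mulVec3]
    rw [vec_eta u] at h0
    simpa using h0
  · push Not at hz
    obtain ⟨P, hP, hFP⟩ := hF.form
    have hc : Continuous F := by
      rw [show F = fun v => eval v P from funext hFP]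
      exact MvPolynomial.continuous_eval P
    obtain ⟨ε, hε, hb⟩ := pos_bound (n := 3) 2 two_ne_zero F hc (fun t v => by
        obtain ⟨a1, a2, a3, a4, a5, a6, a7, a8, a9, a10, a11, a12, a13, a14, a15, e⟩ :=
          hF.form.coeff4
        rw [vec_eta v, show t • ![v 0, v 1, v 2] = ![t * v 0, t * v 1, t * v 2] by simp, e, e]
        ring)
      (fun v hv => lt_of_le_of_ne (hF.nonneg _) (Ne.symm (hz v hv)))
    refine Dom.mk' ![Real.sqrt ε, Real.sqrt ε, Real.sqrt ε, 0, 0, 0] 0 ?_ ?_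
    · simpa using (Real.sqrt_pos.2 hε).ne'
    · intro x y z
      have := hb ![x, y, z]
      simp [Fin.sum_univ_three] at this ⊢
      rwa [← mul_add, ← mul_add, mul_pow, Real.sq_sqrt hε.le]

/-- Every nonnegative ternary quartic is a sum of squares of homogeneous
quadratic polynomials. -/
theorem nonneg_ternary_quartic_is_sum_of_squares
    (p : MvPolynomial (Fin 3) ℝ) (hhom : p.IsHomogeneous 4)
    (hpos : ∀ x : Fin 3 → ℝ, 0 ≤ MvPolynomial.eval x p) :
    ∃ (m : ℕ) (q : Fin m → MvPolynomial (Fin 3) ℝ),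
      (∀ i, (q i).IsHomogeneous 2) ∧ p = ∑ i, (q i) ^ 2 := by
  exact sos_of_dom (fun F h1 h2 h3 => dom_of_good ⟨h1, h2, h3⟩) p hhom hpos
end

section
/- Hilbert's ternary quartic theorem: if p(x,y,z) = Σ_{i+j+k=4} p_{ijk} x^i y^j z^k is a homogeneous real polynomial of degree 4 in three variables satisfying p(x,y,z) ≥ 0 for all real x, y, z, then there exist three homogeneous quadratic polynomials q_1, q_2, q_3 in x, y, z with real coefficients such that p = q_1^2 + q_2^2 + q_3^2. -/
namespace HTQ

/-- Evaluation of a linear form with given coefficients. -/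
def ev1 {K : Type*} [CommRing K] (a v : Fin 3 → K) : K := a 0 * v 0 + a 1 * v 1 + a 2 * v 2

/-- Evaluation of a quadratic form with given coefficients. -/
def ev2 {K : Type*} [CommRing K] (q : Fin 6 → K) (v : Fin 3 → K) : K :=
  q 0 * v 0 ^ 2 + q 1 * (v 0 * v 1) + q 2 * (v 0 * v 2) + q 3 * v 1 ^ 2 + q 4 * (v 1 * v 2)
    + q 5 * v 2 ^ 2

/-- Evaluation of a quartic form with given coefficients. -/
def ev4 {K : Type*} [CommRing K] (c : Fin 15 → K) (v : Fin 3 → K) : K :=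
  c 0 * v 0 ^ 4 + c 1 * (v 0 ^ 3 * v 1) + c 2 * (v 0 ^ 3 * v 2) + c 3 * (v 0 ^ 2 * v 1 ^ 2)
  + c 4 * (v 0 ^ 2 * v 1 * v 2) + c 5 * (v 0 ^ 2 * v 2 ^ 2) + c 6 * (v 0 * v 1 ^ 3)
  + c 7 * (v 0 * v 1 ^ 2 * v 2) + c 8 * (v 0 * v 1 * v 2 ^ 2) + c 9 * (v 0 * v 2 ^ 3)
  + c 10 * v 1 ^ 4 + c 11 * (v 1 ^ 3 * v 2) + c 12 * (v 1 ^ 2 * v 2 ^ 2) + c 13 * (v 1 * v 2 ^ 3)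
  + c 14 * v 2 ^ 4

/-- Product of two linear forms. -/
def mul11 {K : Type*} [CommRing K] (a b : Fin 3 → K) : Fin 6 → K :=
  ![a 0 * b 0, a 0 * b 1 + a 1 * b 0, a 0 * b 2 + a 2 * b 0, a 1 * b 1, a 1 * b 2 + a 2 * b 1,
    a 2 * b 2]

/-- Product of two quadratic forms. -/
def mul22 {K : Type*} [CommRing K] (p q : Fin 6 → K) : Fin 15 → K :=
  ![p 0 * q 0,
    p 0 * q 1 + p 1 * q 0,
    p 0 * q 2 + p 2 * q 0,
    p 0 * q 3 + p 1 * q 1 + p 3 * q 0,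
    p 0 * q 4 + p 1 * q 2 + p 2 * q 1 + p 4 * q 0,
    p 0 * q 5 + p 2 * q 2 + p 5 * q 0,
    p 1 * q 3 + p 3 * q 1,
    p 1 * q 4 + p 2 * q 3 + p 3 * q 2 + p 4 * q 1,
    p 1 * q 5 + p 2 * q 4 + p 4 * q 2 + p 5 * q 1,
    p 2 * q 5 + p 5 * q 2,
    p 3 * q 3,
    p 3 * q 4 + p 4 * q 3,
    p 3 * q 5 + p 4 * q 4 + p 5 * q 3,
    p 4 * q 5 + p 5 * q 4,
    p 5 * q 5]

lemma ev2_mul11 {K : Type*} [CommRing K] (a b v : Fin 3 → K) :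
    ev2 (mul11 a b) v = ev1 a v * ev1 b v := by
  simp [ev2, ev1, mul11]; ring

lemma ev4_mul22 {K : Type*} [CommRing K] (p q : Fin 6 → K) (v : Fin 3 → K) :
    ev4 (mul22 p q) v = ev2 p v * ev2 q v := by
  simp [ev2, ev4, mul22]; ring

lemma ev1_add {K : Type*} [CommRing K] (a b v : Fin 3 → K) :
    ev1 (a + b) v = ev1 a v + ev1 b v := by simp [ev1]; ring
lemma ev1_smul {K : Type*} [CommRing K] (r : K) (a v : Fin 3 → K) :
    ev1 (r • a) v = r * ev1 a v := by simp [ev1]; ring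
lemma ev2_add {K : Type*} [CommRing K] (a b : Fin 6 → K) (v : Fin 3 → K) :
    ev2 (a + b) v = ev2 a v + ev2 b v := by simp [ev2]; ring
lemma ev2_smul {K : Type*} [CommRing K] (r : K) (a : Fin 6 → K) (v : Fin 3 → K) :
    ev2 (r • a) v = r * ev2 a v := by simp [ev2]; ring
lemma ev4_add {K : Type*} [CommRing K] (a b : Fin 15 → K) (v : Fin 3 → K) :
    ev4 (a + b) v = ev4 a v + ev4 b v := by simp [ev4]; ring
lemma ev4_smul {K : Type*} [CommRing K] (r : K) (a : Fin 15 → K) (v : Fin 3 → K) :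
    ev4 (r • a) v = r * ev4 a v := by simp [ev4]; ring
lemma ev4_sub {K : Type*} [CommRing K] (a b : Fin 15 → K) (v : Fin 3 → K) :
    ev4 (a - b) v = ev4 a v - ev4 b v := by simp [ev4]; ring

lemma ev4_zero_inj (c : Fin 15 → ℝ) (h : ∀ v, ev4 c v = 0) : c = 0 := by
  have H : ∀ x y z : ℝ, ev4 c ![x, y, z] = 0 := fun x y z => h _
  simp only [ev4, Matrix.cons_val_zero, Matrix.cons_val_one, Matrix.cons_val] at H
  have h1 := H 1 0 0
  have h2 := H 0 1 0
  have h3 := H 0 0 1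
  have h4 := H 1 1 0
  have h5 := H 1 (-1) 0
  have h6 := H 1 2 0
  have h7 := H 1 0 1
  have h8 := H 1 0 (-1)
  have h9 := H 1 0 2
  have h10 := H 0 1 1
  have h11 := H 0 1 (-1)
  have h12 := H 0 1 2
  have h13 := H 1 1 1
  have h14 := H 1 1 (-1)
  have h15 := H 1 (-1) 1
  norm_num at h1 h2 h3 h4 h5 h6 h7 h8 h9 h10 h11 h12 h13 h14 h15
  ext i
  fin_cases i <;> simp only [Fin.zero_eta, Fin.mk_one, Fin.reduceFinMk, Pi.zero_apply] <;> linarith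

lemma ev4_inj (c d : Fin 15 → ℝ) (h : ∀ v, ev4 c v = ev4 d v) : c = d := by
  refine sub_eq_zero.mp (ev4_zero_inj _ fun v => ?_)
  rw [ev4_sub, h, sub_self]

/-! ### Algebra over the complex numbers -/

/-- Complex functions on `ℂ³`. -/
abbrev Fn := (Fin 3 → ℂ) → ℂ

/-- The space of linear forms. -/
def N : Submodule ℂ Fn := Submodule.span ℂ (Set.range fun (i : Fin 3) (v : Fin 3 → ℂ) => v i)

lemma coord_mem (i : Fin 3) : (fun v => v i : Fn) ∈ N := Submodule.subset_span ⟨i, rfl⟩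

lemma mem_N_iff (φ : Fn) : φ ∈ N ↔ ∃ a : Fin 3 → ℂ, φ = ev1 a := by
  rw [N, Submodule.mem_span_range_iff_exists_fun]
  constructor
  · rintro ⟨c, rfl⟩
    exact ⟨c, by ext v; simp [ev1, Fin.sum_univ_three]⟩
  · rintro ⟨c, rfl⟩
    exact ⟨c, by ext v; simp [ev1, Fin.sum_univ_three]⟩

lemma mem_N2 (φ : Fn) (h : φ ∈ N ^ 2) : ∃ a : Fin 6 → ℂ, φ = ev2 a := by
  rw [pow_two] at h
  induction h using Submodule.mul_induction_on' with
  | mem_mul_mem m hm n hn =>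
    obtain ⟨a, rfl⟩ := (mem_N_iff _).1 hm
    obtain ⟨b, rfl⟩ := (mem_N_iff _).1 hn
    exact ⟨mul11 a b, by ext v; simp [ev2_mul11]⟩
  | add x hx y hy h1 h2 =>
    obtain ⟨a, rfl⟩ := h1
    obtain ⟨b, rfl⟩ := h2
    exact ⟨a + b, by ext v; simp [ev2_add]⟩

lemma ev2_mem (q : Fin 6 → ℂ) : (ev2 q : Fn) ∈ N ^ 2 := by
  have hc : ∀ i j : Fin 3, (fun v => v i * v j : Fn) ∈ N ^ 2 := fun i j => by
    rw [pow_two]; exact Submodule.mul_mem_mul (coord_mem i) (coord_mem j)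
  have : (ev2 q : Fn) = q 0 • (fun v => v 0 * v 0 : Fn) + q 1 • (fun v => v 0 * v 1 : Fn)
      + q 2 • (fun v => v 0 * v 2 : Fn) + q 3 • (fun v => v 1 * v 1 : Fn)
      + q 4 • (fun v => v 1 * v 2 : Fn) + q 5 • (fun v => v 2 * v 2 : Fn) := by
    ext v; simp [ev2]; ring
  rw [this]
  refine add_mem (add_mem (add_mem (add_mem (add_mem ?_ ?_) ?_) ?_) ?_) ?_ <;>
    exact Submodule.smul_mem _ _ (hc _ _)

lemma ev4_mem (q : Fin 15 → ℂ) : (ev4 q : Fn) ∈ N ^ 4 := by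
  have hc : ∀ i j k l : Fin 3, (fun v => v i * v j * (v k * v l) : Fn) ∈ N ^ 4 := fun i j k l => by
    have : N ^ 4 = (N * N) * (N * N) := by ring
    rw [this]
    exact Submodule.mul_mem_mul (Submodule.mul_mem_mul (coord_mem i) (coord_mem j))
      (Submodule.mul_mem_mul (coord_mem k) (coord_mem l))
  have : (ev4 q : Fn) = q 0 • (fun v => v 0 * v 0 * (v 0 * v 0) : Fn)
      + q 1 • (fun v => v 0 * v 0 * (v 0 * v 1) : Fn)
      + q 2 • (fun v => v 0 * v 0 * (v 0 * v 2) : Fn)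
      + q 3 • (fun v => v 0 * v 0 * (v 1 * v 1) : Fn)
      + q 4 • (fun v => v 0 * v 0 * (v 1 * v 2) : Fn)
      + q 5 • (fun v => v 0 * v 0 * (v 2 * v 2) : Fn)
      + q 6 • (fun v => v 0 * v 1 * (v 1 * v 1) : Fn)
      + q 7 • (fun v => v 0 * v 1 * (v 1 * v 2) : Fn)
      + q 8 • (fun v => v 0 * v 1 * (v 2 * v 2) : Fn)
      + q 9 • (fun v => v 0 * v 2 * (v 2 * v 2) : Fn)
      + q 10 • (fun v => v 1 * v 1 * (v 1 * v 1) : Fn)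
      + q 11 • (fun v => v 1 * v 1 * (v 1 * v 2) : Fn)
      + q 12 • (fun v => v 1 * v 1 * (v 2 * v 2) : Fn)
      + q 13 • (fun v => v 1 * v 2 * (v 2 * v 2) : Fn)
      + q 14 • (fun v => v 2 * v 2 * (v 2 * v 2) : Fn) := by
    ext v; simp [ev4]; ring
  rw [this]
  repeat' refine add_mem ?_ ?_
  all_goals exact Submodule.smul_mem _ _ (hc _ _ _ _)

/-- Two linear forms in three variables have a common nontrivial zero. -/
lemma exists_zero (φ ψ : Fn) (h1 : φ ∈ N) (h2 : ψ ∈ N) : ∃ P : Fin 3 → ℂ, P ≠ 0 ∧ φ P = 0 ∧ ψ P = 0 := by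
  obtain ⟨a, rfl⟩ := (mem_N_iff _).1 h1
  obtain ⟨b, rfl⟩ := (mem_N_iff _).1 h2
  have hd : (Matrix.of ![a, b, 0]).det = 0 := Matrix.det_eq_zero_of_row_eq_zero 2 (by simp)
  obtain ⟨P, hP, h⟩ := Matrix.exists_mulVec_eq_zero_iff.2 hd
  refine ⟨P, hP, ?_, ?_⟩
  · simpa [Matrix.mulVec, dotProduct, Fin.sum_univ_three, ev1] using congrFun h 0
  · simpa [Matrix.mulVec, dotProduct, Fin.sum_univ_three, ev1] using congrFun h 1

open Submodule in
lemma point_lemma (l a c q : Fn) (hl : l ∈ N) (ha : a ∈ N) (hc : c ∈ N)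
    (hN : N ≤ span ℂ {l} ⊔ span ℂ {a} ⊔ span ℂ {c}) (hq : q ∈ N ^ 2)
    (P : Fin 3 → ℂ) (hlP : l P = 0) (haP : a P = 0) (hqP : q P ≠ 0) :
    N ^ 2 ≤ span ℂ {q} ⊔ span ℂ {l} * N ⊔ span ℂ {a} * N := by
  have h1 : N ^ 2 ≤ span ℂ {c * c} ⊔ span ℂ {l} * N ⊔ span ℂ {a} * N := by
    calc N ^ 2 = N * N := pow_two N
      _ ≤ (span ℂ {l} ⊔ span ℂ {a} ⊔ span ℂ {c}) * N := mul_le_mul' hN le_rfl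
      _ = span ℂ {l} * N ⊔ span ℂ {a} * N ⊔ span ℂ {c} * N := by
        rw [Submodule.sup_mul, Submodule.sup_mul]
      _ ≤ _ := by
        refine sup_le (sup_le (le_sup_of_le_left le_sup_right) le_sup_right) ?_
        have hcN : span ℂ {c} ≤ N := by simpa [span_le] using hc
        calc span ℂ {c} * N ≤ span ℂ {c} * (span ℂ {l} ⊔ span ℂ {a} ⊔ span ℂ {c}) :=
              mul_le_mul' le_rfl hN
          _ = span ℂ {l} * span ℂ {c} ⊔ span ℂ {a} * span ℂ {c} ⊔ span ℂ {c * c} := by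
            rw [Submodule.mul_sup, Submodule.mul_sup, span_mul_span, span_mul_span, span_mul_span, span_mul_span,
              span_mul_span]
            simp [mul_comm]
          _ ≤ _ := by
            refine sup_le (sup_le ?_ ?_) (le_sup_of_le_left le_sup_left)
            · exact (mul_le_mul' le_rfl hcN).trans (le_sup_of_le_left le_sup_right)
            · exact (mul_le_mul' le_rfl hcN).trans le_sup_right
  have hq' := h1 hq
  obtain ⟨y, hy, z, hz, hyz⟩ := mem_sup.1 hq'
  obtain ⟨y1, hy1, y2, hy2, rfl⟩ := mem_sup.1 hy
  obtain ⟨k, rfl⟩ := mem_span_singleton.1 hy1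
  obtain ⟨m, hm, rfl⟩ := mem_span_singleton_mul.1 hy2
  obtain ⟨n, hn, rfl⟩ := mem_span_singleton_mul.1 hz
  have hk : k ≠ 0 := by
    rintro rfl
    apply hqP
    rw [← hyz]; simp [hlP, haP]
  refine h1.trans (sup_le (sup_le ?_ (le_sup_of_le_left le_sup_right)) le_sup_right)
  rw [span_le, Set.singleton_subset_iff]
  have : c * c = k⁻¹ • q + l * (-k⁻¹ • m) + a * (-k⁻¹ • n) := by
    rw [← hyz]; ext v; simp; field_simp; ring
  rw [this]
  refine add_mem_sup (add_mem_sup ?_ ?_) ?_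
  · exact smul_mem _ _ (mem_span_singleton_self q)
  · exact mul_mem_mul (mem_span_singleton_self l) (smul_mem _ _ hm)
  · exact mul_mem_mul (mem_span_singleton_self a) (smul_mem _ _ hn)

end HTQ

namespace HTQ

open Submodule in
lemma complete_lemma (l s t a : Fn) (hs : s ∈ N) (ht : t ∈ N)
    (hN : N ≤ span ℂ {l} ⊔ span ℂ {s} ⊔ span ℂ {t}) (α β : ℂ) (hab : α ≠ 0 ∨ β ≠ 0)
    (ha : a = α • s + β • t) : ∃ c ∈ N, N ≤ span ℂ {l} ⊔ span ℂ {a} ⊔ span ℂ {c} := by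
  rcases hab with h | h
  · refine ⟨t, ht, hN.trans (sup_le (sup_le (le_sup_of_le_left le_sup_left) ?_) le_sup_right)⟩
    rw [span_le, Set.singleton_subset_iff]
    have : s = α⁻¹ • a + (-α⁻¹ * β) • t := by
      rw [ha]; ext v; simp; field_simp; ring
    rw [this]
    exact add_mem (mem_sup_left (mem_sup_right (smul_mem _ _ (mem_span_singleton_self a))))
      (mem_sup_right (smul_mem _ _ (mem_span_singleton_self t)))
  · refine ⟨s, hs, hN.trans (sup_le (sup_le (le_sup_of_le_left le_sup_left) le_sup_right) ?_)⟩
    rw [span_le, Set.singleton_subset_iff]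
    have : t = β⁻¹ • a + (-β⁻¹ * α) • s := by
      rw [ha]; ext v; simp; field_simp; ring
    rw [this]
    exact add_mem (mem_sup_left (mem_sup_right (smul_mem _ _ (mem_span_singleton_self a))))
      (mem_sup_right (smul_mem _ _ (mem_span_singleton_self s)))

open Submodule in
lemma exists_st (l : Fn) (hl : l ∈ N) (h0 : l ≠ 0) :
    ∃ s ∈ N, ∃ t ∈ N, N ≤ span ℂ {l} ⊔ span ℂ {s} ⊔ span ℂ {t} := by
  obtain ⟨a, rfl⟩ := (mem_N_iff _).1 hl
  have : ∃ k, a k ≠ 0 := by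
    by_contra! h
    apply h0; ext v; simp [ev1, h]
  obtain ⟨k, hk⟩ := this
  refine ⟨_, coord_mem (k + 1), _, coord_mem (k + 2), ?_⟩
  have e0 : (fun v => v k : Fn) = (a k)⁻¹ • (ev1 a) + (-(a k)⁻¹ * a (k + 1)) • (fun v => v (k + 1) : Fn)
      + (-(a k)⁻¹ * a (k + 2)) • (fun v => v (k + 2) : Fn) := by
    ext v
    have : ev1 a v = a k * v k + a (k + 1) * v (k + 1) + a (k + 2) * v (k + 2) := by
      fin_cases k <;> simp [ev1] <;> ring
    simp only [Pi.add_apply, Pi.smul_apply, smul_eq_mul, this]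
    field_simp; ring
  have m0 : (fun v => v k : Fn) ∈ span ℂ {(ev1 a : Fn)} ⊔ span ℂ {(fun v => v (k + 1) : Fn)} ⊔
      span ℂ {(fun v => v (k + 2) : Fn)} := by
    rw [e0]
    exact add_mem_sup (add_mem_sup (smul_mem _ _ (mem_span_singleton_self _))
      (smul_mem _ _ (mem_span_singleton_self _))) (smul_mem _ _ (mem_span_singleton_self _))
  have m1 : (fun v => v (k + 1) : Fn) ∈ span ℂ {(ev1 a : Fn)} ⊔ span ℂ {(fun v => v (k + 1) : Fn)} ⊔
      span ℂ {(fun v => v (k + 2) : Fn)} := mem_sup_left (mem_sup_right (mem_span_singleton_self _))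
  have m2 : (fun v => v (k + 2) : Fn) ∈ span ℂ {(ev1 a : Fn)} ⊔ span ℂ {(fun v => v (k + 1) : Fn)} ⊔
      span ℂ {(fun v => v (k + 2) : Fn)} := mem_sup_right (mem_span_singleton_self _)
  conv_lhs => rw [N]
  rw [span_le]
  rintro _ ⟨i, rfl⟩
  have := (by decide : ∀ i k : Fin 3, i = k ∨ i = k + 1 ∨ i = k + 2) i k
  rcases this with rfl | rfl | rfl
  · exact m0
  · exact m1
  · exact m2

open Submodule in
lemma binary_lemma (l q : Fn) (hl : l ∈ N) (h0 : l ≠ 0) (hq : q ∈ N ^ 2) :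
    (∃ m ∈ N, q = l * m) ∨ (∃ a ∈ N, ∃ b ∈ N, ∃ c ∈ N, ∃ d ∈ N,
      N ≤ span ℂ {l} ⊔ span ℂ {a} ⊔ span ℂ {c} ∧ N ≤ span ℂ {l} ⊔ span ℂ {b} ⊔ span ℂ {d} ∧
      ∃ m ∈ N, q = a * b + l * m) := by
  obtain ⟨s, hs, t, ht, hN⟩ := exists_st l hl h0
  have hsN : span ℂ {s} ≤ N := by simpa [span_le] using hs
  have htN : span ℂ {t} ≤ N := by simpa [span_le] using ht
  have h1 : N ^ 2 ≤ span ℂ {l} * N ⊔ (span ℂ {s * s} ⊔ span ℂ {s * t} ⊔ span ℂ {t * t}) := by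
    have hS : span ℂ {s} * N ≤ span ℂ {l} * N ⊔ (span ℂ {s * s} ⊔ span ℂ {s * t} ⊔ span ℂ {t * t}) := by
      refine (mul_le_mul' le_rfl hN).trans ?_
      rw [Submodule.mul_sup, Submodule.mul_sup]
      refine sup_le (sup_le ?_ ?_) ?_
      · rw [mul_comm]; exact le_sup_of_le_left (mul_le_mul' le_rfl hsN)
      · rw [span_mul_span]; simp only [Set.singleton_mul_singleton]
        exact le_sup_of_le_right (le_sup_of_le_left le_sup_left)
      · rw [span_mul_span]; simp only [Set.singleton_mul_singleton]
        exact le_sup_of_le_right (le_sup_of_le_left le_sup_right)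
    have hT : span ℂ {t} * N ≤ span ℂ {l} * N ⊔ (span ℂ {s * s} ⊔ span ℂ {s * t} ⊔ span ℂ {t * t}) := by
      refine (mul_le_mul' le_rfl hN).trans ?_
      rw [Submodule.mul_sup, Submodule.mul_sup]
      refine sup_le (sup_le ?_ ?_) ?_
      · rw [mul_comm]; exact le_sup_of_le_left (mul_le_mul' le_rfl htN)
      · rw [mul_comm, span_mul_span]; simp only [Set.singleton_mul_singleton]
        exact le_sup_of_le_right (le_sup_of_le_left le_sup_right)
      · rw [span_mul_span]; simp only [Set.singleton_mul_singleton]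
        exact le_sup_of_le_right le_sup_right
    calc N ^ 2 = N * N := pow_two N
      _ ≤ (span ℂ {l} ⊔ span ℂ {s} ⊔ span ℂ {t}) * N := mul_le_mul' hN le_rfl
      _ = span ℂ {l} * N ⊔ span ℂ {s} * N ⊔ span ℂ {t} * N := by
        rw [Submodule.sup_mul, Submodule.sup_mul]
      _ ≤ _ := sup_le (sup_le le_sup_left hS) hT
  obtain ⟨y, hy, z, hz, rfl⟩ := mem_sup.1 (h1 hq)
  obtain ⟨m, hm, rfl⟩ := mem_span_singleton_mul.1 hy
  obtain ⟨z1, hz1, z2, hz2, rfl⟩ := mem_sup.1 hz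
  obtain ⟨z3, hz3, z4, hz4, rfl⟩ := mem_sup.1 hz1
  obtain ⟨A, rfl⟩ := mem_span_singleton.1 hz3
  obtain ⟨B, rfl⟩ := mem_span_singleton.1 hz4
  obtain ⟨C, rfl⟩ := mem_span_singleton.1 hz2
  -- a product of two nonzero combinations of s and t
  have key : ∀ α β γ δ : ℂ, (α ≠ 0 ∨ β ≠ 0) → (γ ≠ 0 ∨ δ ≠ 0) →
      A • (s * s) + B • (s * t) + C • (t * t) = (α • s + β • t) * (γ • s + δ • t) →
      (∃ a ∈ N, ∃ b ∈ N, ∃ c ∈ N, ∃ d ∈ N,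
      N ≤ span ℂ {l} ⊔ span ℂ {a} ⊔ span ℂ {c} ∧ N ≤ span ℂ {l} ⊔ span ℂ {b} ⊔ span ℂ {d} ∧
      ∃ m' ∈ N, l * m + (A • (s * s) + B • (s * t) + C • (t * t)) = a * b + l * m') := by
    intro α β γ δ h1 h2 h
    obtain ⟨c, hc, hc'⟩ := complete_lemma l s t _ hs ht hN α β h1 rfl
    obtain ⟨d, hd, hd'⟩ := complete_lemma l s t _ hs ht hN γ δ h2 rfl
    refine ⟨_, ?_, _, ?_, c, hc, d, hd, hc', hd', m, hm, ?_⟩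
    · exact add_mem (smul_mem _ _ hs) (smul_mem _ _ ht)
    · exact add_mem (smul_mem _ _ hs) (smul_mem _ _ ht)
    · rw [h, add_comm]
  by_cases hA : A = 0
  · by_cases hBC : B = 0 ∧ C = 0
    · left
      refine ⟨m, hm, ?_⟩
      rw [hA, hBC.1, hBC.2]; simp
    · right
      refine key 0 1 B C (Or.inr one_ne_zero) (by tauto) ?_
      rw [hA]; ext v; simp; ring
  · right
    obtain ⟨d, hd⟩ := IsAlgClosed.exists_pow_nat_eq (B ^ 2 - 4 * A * C) (n := 2) (by norm_num)
    refine key A ((B - d) / 2) 1 ((B + d) / (2 * A)) (Or.inl hA) (Or.inl one_ne_zero) ?_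
    ext v; simp; field_simp
    linear_combination (t v ^ 2 ) * hd

open Submodule in
lemma line_lemma (l q r : Fn) (hl : l ∈ N) (h0 : l ≠ 0) (hq : q ∈ N ^ 2) (hr : r ∈ N ^ 2)
    (hz : ∀ P : Fin 3 → ℂ, P ≠ 0 → l P = 0 → q P = 0 → r P ≠ 0) :
    N ^ 3 ≤ span ℂ {q} * N ⊔ span ℂ {r} * N ⊔ span ℂ {l} * N ^ 2 := by
  rcases binary_lemma l q hl h0 hq with ⟨m, hm, h⟩ | ⟨a, ha, b, hb, c, hc, d, hd, hac, hbd, m, hm, h⟩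
  · exfalso
    rcases binary_lemma l r hl h0 hr with ⟨m', hm', h'⟩ | ⟨a, ha, b, hb, c, hc, d, hd, hac, hbd, m', hm', h'⟩
    · obtain ⟨P, hP, h1, h2⟩ := exists_zero l l hl hl
      exact hz P hP h1 (by simp [h, h1]) (by simp [h', h1])
    · obtain ⟨P, hP, h1, h2⟩ := exists_zero l a hl ha
      exact hz P hP h1 (by simp [h, h1]) (by simp [h', h1, h2])
  · obtain ⟨P, hP, h1, h2⟩ := exists_zero l a hl ha
    have e1 := point_lemma l a c r hl ha hc hac hr P h1 h2 (hz P hP h1 (by simp [h, h1, h2]))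
    obtain ⟨P, hP, h1, h2⟩ := exists_zero l b hl hb
    have e2 := point_lemma l b d r hl hb hd hbd hr P h1 h2 (hz P hP h1 (by simp [h, h1, h2]))
    have e3 : span ℂ {a} * span ℂ {b} ≤ span ℂ {q} ⊔ span ℂ {l} * N := by
      rw [span_mul_span, Set.singleton_mul_singleton, span_le, Set.singleton_subset_iff]
      have : a * b = q + l * (-m) := by rw [h]; ring
      rw [this]
      exact add_mem_sup (mem_span_singleton_self _) (mul_mem_mul (mem_span_singleton_self _)
        (neg_mem hm))
    have haN : span ℂ {a} ≤ N := by simpa [span_le] using ha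
    generalize span ℂ {a} = A at *
    generalize span ℂ {b} = B at *
    generalize span ℂ {q} = Q at *
    generalize span ℂ {r} = R at *
    generalize span ℂ {l} = L at *
    simp only [← Submodule.add_eq_sup] at *
    calc N ^ 3 = N ^ 2 * N := by ring
      _ ≤ (R + L * N + A * N) * N := mul_le_mul' e1 le_rfl
      _ = R * N + L * N ^ 2 + A * N ^ 2 := by ring
      _ ≤ R * N + L * N ^ 2 + A * (R + L * N + B * N) := by gcongr
      _ = R * N + L * N ^ 2 + (R * A + L * A * N + (A * B) * N) := by ring
      _ ≤ R * N + L * N ^ 2 + (R * N + L * N * N + (Q + L * N) * N) := by gcongr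
      _ = Q * N + (R * N + R * N) + (L * N ^ 2 + L * N ^ 2 + L * N ^ 2) := by ring
      _ = _ := by simp only [Submodule.add_eq_sup, sup_idem]

open Submodule in
lemma net_lemma (l m q r : Fn) (hl : l ∈ N) (hl0 : l ≠ 0) (hm : m ∈ N) (hm0 : m ≠ 0)
    (hq : q ∈ N ^ 2) (hr : r ∈ N ^ 2)
    (hz : ∀ P : Fin 3 → ℂ, P ≠ 0 → (l * m) P = 0 → q P = 0 → r P ≠ 0) :
    N ^ 4 ≤ span ℂ {l * m} * N ^ 2 ⊔ span ℂ {q} * N ^ 2 ⊔ span ℂ {r} * N ^ 2 := by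
  have e1 := line_lemma l q r hl hl0 hq hr (fun P hP h => hz P hP (by simp [h]))
  have e2 := line_lemma m q r hm hm0 hq hr (fun P hP h => hz P hP (by simp [h]))
  have hlN : span ℂ {l} ≤ N := by simpa [span_le] using hl
  have : span ℂ {l * m} = span ℂ {l} * span ℂ {m} := by
    rw [span_mul_span, Set.singleton_mul_singleton]
  rw [this]
  generalize span ℂ {q} = Q at *
  generalize span ℂ {r} = R at *
  generalize span ℂ {l} = L at *
  generalize span ℂ {m} = M at *
  simp only [← Submodule.add_eq_sup] at *
  calc N ^ 4 = N ^ 3 * N := by ring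
    _ ≤ (Q * N + R * N + L * N ^ 2) * N := mul_le_mul' e1 le_rfl
    _ = Q * N ^ 2 + R * N ^ 2 + L * N ^ 3 := by ring
    _ ≤ Q * N ^ 2 + R * N ^ 2 + L * (Q * N + R * N + M * N ^ 2) := by gcongr
    _ = Q * N ^ 2 + R * N ^ 2 + (Q * L * N + R * L * N + L * M * N ^ 2) := by ring
    _ ≤ Q * N ^ 2 + R * N ^ 2 + (Q * N * N + R * N * N + L * M * N ^ 2) := by gcongr
    _ = L * M * N ^ 2 + (Q * N ^ 2 + Q * N ^ 2) + (R * N ^ 2 + R * N ^ 2) := by ring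
    _ = _ := by simp only [Submodule.add_eq_sup, sup_idem]

end HTQ

namespace HTQ

lemma cubic_zero (k0 k1 k2 k3 : ℂ) : ∃ w1 w2 : ℂ, (w1 ≠ 0 ∨ w2 ≠ 0) ∧
    k0 * w1 ^ 3 + k1 * (w1 ^ 2 * w2) + k2 * (w1 * w2 ^ 2) + k3 * w2 ^ 3 = 0 := by
  by_cases h : k3 = 0
  · exact ⟨0, 1, Or.inr one_ne_zero, by simp [h]⟩
  · obtain ⟨t, ht⟩ := IsAlgClosed.exists_root (Polynomial.C k3 * Polynomial.X ^ 3 +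
      Polynomial.C k2 * Polynomial.X ^ 2 + Polynomial.C k1 * Polynomial.X + Polynomial.C k0)
      (by rw [Polynomial.degree_cubic h]; norm_num)
    refine ⟨1, t, Or.inl one_ne_zero, ?_⟩
    simp [Polynomial.IsRoot] at ht
    linear_combination ht

lemma split_lemma (q : Fin 6 → ℂ) (w1 w2 : ℂ) (hw : w1 ≠ 0 ∨ w2 ≠ 0) (h1 : q 5 = 0)
    (h2 : q 2 * w1 + q 4 * w2 = 0) (h3 : q 0 * w1 ^ 2 + q 1 * (w1 * w2) + q 3 * w2 ^ 2 = 0) :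
    ∃ l ∈ N, ∃ m ∈ N, l ≠ 0 ∧ (ev2 q : Fn) = l * m := by
  refine ⟨ev1 ![w2, -w1, 0], (mem_N_iff _).2 ⟨_, rfl⟩, ?_⟩
  have hl : (ev1 ![w2, -w1, 0] : Fn) ≠ 0 := by
    intro h
    have e1 := congrFun h ![1, 0, 0]
    have e2 := congrFun h ![0, 1, 0]
    simp [ev1] at e1 e2
    tauto
  by_cases h : w2 = 0
  · have hw1 : w1 ≠ 0 := by tauto
    refine ⟨ev1 ![-q 1 / w1, -q 3 / w1, -q 4 / w1], (mem_N_iff _).2 ⟨_, rfl⟩, hl, ?_⟩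
    subst h
    have e0 : q 0 = 0 := by simpa [hw1] using h3
    have e2 : q 2 = 0 := by simpa [hw1] using h2
    ext v
    simp [ev1, ev2, e0, e2, h1]; field_simp; ring
  · refine ⟨ev1 ![q 0 / w2, (q 1 + w1 * (q 0 / w2)) / w2, q 2 / w2],
      (mem_N_iff _).2 ⟨_, rfl⟩, hl, ?_⟩
    have e4 : q 4 = - q 2 * w1 / w2 := by field_simp; linear_combination h2
    have e3 : q 3 = - (q 0 * w1 ^ 2 + q 1 * (w1 * w2)) / w2 ^ 2 := by
      field_simp; linear_combination h3
    ext v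
    simp [ev1, ev2, e3, e4, h1]; field_simp; ring

lemma exists_singular (q : Fin 3 → Fin 6 → ℂ) : ∃ c : Fin 3 → ℂ, c ≠ 0 ∧
    ∃ l ∈ N, ∃ m ∈ N, l ≠ 0 ∧
      (ev2 (c 0 • q 0 + c 1 • q 1 + c 2 • q 2) : Fn) = l * m := by
  let D : Fin 6 → Fin 6 → Fin 6 → ℂ := fun a b c =>
    q 0 a * q 1 b * q 2 c - q 0 a * q 1 c * q 2 b - q 0 b * q 1 a * q 2 c + q 0 b * q 1 c * q 2 a
    + q 0 c * q 1 a * q 2 b - q 0 c * q 1 b * q 2 a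
  obtain ⟨w1, w2, hw, h⟩ := cubic_zero (D 5 2 0) (D 5 2 1 + D 5 4 0) (D 5 2 3 + D 5 4 1) (D 5 4 3)
  let M : Matrix (Fin 3) (Fin 3) ℂ := Matrix.of fun i =>
    ![q i 5, q i 2 * w1 + q i 4 * w2, q i 0 * w1 ^ 2 + q i 1 * (w1 * w2) + q i 3 * w2 ^ 2]
  have hM : M.det = 0 := by
    rw [← h, Matrix.det_fin_three]; simp [M, D]; ring
  obtain ⟨c, hc, hcM⟩ := Matrix.exists_vecMul_eq_zero_iff.2 hM
  refine ⟨c, hc, split_lemma _ w1 w2 hw ?_ ?_ ?_⟩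
  · have := congrFun hcM 0
    simp [Matrix.vecMul, dotProduct, Fin.sum_univ_three, M] at this
    simpa using this
  · have := congrFun hcM 1
    simp [Matrix.vecMul, dotProduct, Fin.sum_univ_three, M] at this
    simp
    linear_combination this
  · have := congrFun hcM 2
    simp [Matrix.vecMul, dotProduct, Fin.sum_univ_three, M] at this
    simp
    linear_combination this

lemma ev2_eq_zero (q : Fin 6 → ℂ) (h : (ev2 q : Fn) = 0) : q = 0 := by
  have H : ∀ x y z : ℂ, ev2 q ![x, y, z] = 0 := fun x y z => congrFun h _
  simp only [ev2, Matrix.cons_val_zero, Matrix.cons_val_one, Matrix.cons_val] at H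
  have h1 := H 1 0 0
  have h2 := H 0 1 0
  have h3 := H 0 0 1
  have h4 := H 1 1 0
  have h5 := H 1 0 1
  have h6 := H 0 1 1
  norm_num at h1 h2 h3 h4 h5 h6
  ext i
  fin_cases i <;> simp only [Fin.zero_eta, Fin.mk_one, Fin.reduceFinMk, Pi.zero_apply]
  · exact h1
  · linear_combination h4 - h1 - h2
  · linear_combination h5 - h1 - h3
  · exact h2
  · linear_combination h6 - h2 - h3
  · exact h3

open Submodule in
lemma surj_complex (q : Fin 3 → Fin 6 → ℂ)
    (hind : ∀ c : Fin 3 → ℂ, c 0 • q 0 + c 1 • q 1 + c 2 • q 2 = 0 → c = 0)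
    (hz : ∀ P : Fin 3 → ℂ, P ≠ 0 → ∃ i, ev2 (q i) P ≠ 0) (g : Fin 15 → ℂ) :
    ∃ h : Fin 3 → Fin 6 → ℂ, ∀ v, ev4 g v = ∑ i, ev2 (q i) v * ev2 (h i) v := by
  obtain ⟨c, hc, l, hl, m, hm, hl0, hlm⟩ := exists_singular q
  have hm0 : m ≠ 0 := by
    rintro rfl
    exact hc (hind c (ev2_eq_zero _ (by rw [hlm]; simp)))
  obtain ⟨k, hk⟩ : ∃ k, c k ≠ 0 := by
    by_contra! h
    exact hc (funext h)
  have hlm' : ∀ P, l P * m P = c k * ev2 (q k) P + c (k + 1) * ev2 (q (k + 1)) P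
      + c (k + 2) * ev2 (q (k + 2)) P := by
    intro P
    have := congrFun hlm P
    rw [ev2_add, ev2_add, ev2_smul, ev2_smul, ev2_smul] at this
    rw [Pi.mul_apply] at this
    rw [← this]
    fin_cases k <;> simp <;> ring
  have key := net_lemma l m (ev2 (q (k + 1))) (ev2 (q (k + 2))) hl hl0 hm hm0 (ev2_mem _) (ev2_mem _) (by
    intro P hP h1 h2 h3
    obtain ⟨i, hi⟩ := hz P hP
    have := (by decide : ∀ i k : Fin 3, i = k ∨ i = k + 1 ∨ i = k + 2) i k
    rcases this with rfl | rfl | rfl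
    · have := hlm' P
      rw [Pi.mul_apply] at h1
      rw [h1, h2, h3] at this
      simp [hk, hi] at this
    · exact hi h2
    · exact hi h3) (ev4_mem g)
  obtain ⟨y, hy, z, hz', hyz⟩ := mem_sup.1 key
  obtain ⟨y1, hy1, y2, hy2, rfl⟩ := mem_sup.1 hy
  obtain ⟨u1, hu1, rfl⟩ := mem_span_singleton_mul.1 hy1
  obtain ⟨u2, hu2, rfl⟩ := mem_span_singleton_mul.1 hy2
  obtain ⟨u3, hu3, rfl⟩ := mem_span_singleton_mul.1 hz'
  obtain ⟨a1, rfl⟩ := mem_N2 _ hu1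
  obtain ⟨a2, rfl⟩ := mem_N2 _ hu2
  obtain ⟨a3, rfl⟩ := mem_N2 _ hu3
  refine ⟨fun i => if i = k then c k • a1 else if i = k + 1 then c (k + 1) • a1 + a2 else
    c (k + 2) • a1 + a3, fun v => ?_⟩
  have e := congrFun hyz v
  simp only [Pi.add_apply, Pi.mul_apply, hlm'] at e
  rw [← e, Fin.sum_univ_three]
  fin_cases k <;> simp [ev2_add, ev2_smul] <;> ring

/-- Surjectivity of the differential in the real setting. -/
lemma surj_real (q : Fin 3 → Fin 6 → ℝ)
    (hind : ∀ c : Fin 3 → ℝ, c 0 • q 0 + c 1 • q 1 + c 2 • q 2 = 0 → c = 0)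
    (hz : ∀ P : Fin 3 → ℂ, P ≠ 0 → ∃ i, ev2 (fun j => (q i j : ℂ)) P ≠ 0) (g : Fin 15 → ℝ) :
    ∃ h : Fin 3 → Fin 6 → ℝ, g = ∑ i, mul22 (q i) (h i) := by
  obtain ⟨h, hh⟩ := surj_complex (fun i j => (q i j : ℂ)) (by
    intro c hc
    have hre := hind (fun i => (c i).re) (by
      ext j
      have := congrArg Complex.re (congrFun hc j)
      simpa using this)
    have him := hind (fun i => (c i).im) (by
      ext j
      have := congrArg Complex.im (congrFun hc j)
      simpa using this)
    ext i
    exact Complex.ext (congrFun hre i) (congrFun him i)) hz (fun j => (g j : ℂ))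
  refine ⟨fun i j => (h i j).re, ev4_inj _ _ fun v => ?_⟩
  have e := congrArg Complex.re (hh (fun i => (v i : ℂ)))
  have e1 : ev4 (fun j => (g j : ℂ)) (fun i => (v i : ℂ)) = ((ev4 g v : ℝ) : ℂ) := by
    simp [ev4]
  have e2 : ∀ i, ev2 (fun j => (q i j : ℂ)) (fun i => (v i : ℂ)) = ((ev2 (q i) v : ℝ) : ℂ) := by
    intro i; simp [ev2]
  have e3 : ∀ i, (ev2 (h i) (fun i => (v i : ℂ))).re = ev2 (fun j => (h i j).re) v := by
    intro i
    simp only [ev2, ← Complex.ofReal_mul, ← Complex.ofReal_pow, Complex.add_re, Complex.re_mul_ofReal]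
  rw [e1] at e
  simp only [e2, Fin.sum_univ_three, Complex.add_re, Complex.re_ofReal_mul, e3, Complex.ofReal_re] at e
  rw [e, Fin.sum_univ_three, ev4_add, ev4_add, ev4_mul22, ev4_mul22, ev4_mul22]

end HTQ

namespace HTQ

/-- Sum of three squares in coordinates. -/
def Phi (q : Fin 3 → Fin 6 → ℝ) : Fin 15 → ℝ :=
  mul22 (q 0) (q 0) + mul22 (q 1) (q 1) + mul22 (q 2) (q 2)

lemma ev4_Phi (q : Fin 3 → Fin 6 → ℝ) (v : Fin 3 → ℝ) :
    ev4 (Phi q) v = ev2 (q 0) v ^ 2 + ev2 (q 1) v ^ 2 + ev2 (q 2) v ^ 2 := by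
  simp only [Phi, ev4_add, ev4_mul22]; ring

/-- Parameters of the bad locus. -/
abbrev Par := (Fin 2 → ℝ) × (Fin 3 → ℝ) × (Fin 2 → ℝ) × (Fin 6 → ℝ)

/-- The linear form `v k - a v i - b v j`. -/
def lam (i j k : Fin 3) (a b : ℝ) : Fin 3 → ℝ :=
  Pi.single k 1 + (-a) • Pi.single i 1 + (-b) • Pi.single j 1

/-- A quadratic form in the two variables `v i`, `v j`. -/
def quad (i j : Fin 3) (a b c : ℝ) : Fin 6 → ℝ :=
  a • mul11 (Pi.single i 1) (Pi.single i 1) + b • mul11 (Pi.single i 1) (Pi.single j 1)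
    + c • mul11 (Pi.single j 1) (Pi.single j 1)

/-- The bad locus: quartics singular at a pair of complex conjugate points. -/
def Psi (i j k : Fin 3) (p : Par) : Fin 15 → ℝ :=
  mul22 (quad i j (p.2.1 0) (p.2.1 1) (p.2.1 2)) (quad i j (p.2.1 0) (p.2.1 1) (p.2.1 2))
  + mul22 (mul11 (lam i j k (p.1 0) (p.1 1))
      (p.2.2.1 0 • Pi.single i 1 + p.2.2.1 1 • Pi.single j 1))
      (quad i j (p.2.1 0) (p.2.1 1) (p.2.1 2))
  + mul22 (mul11 (lam i j k (p.1 0) (p.1 1)) (lam i j k (p.1 0) (p.1 1))) p.2.2.2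

/-- Sums of two squares. -/
def Psi2 (p : (Fin 6 → ℝ) × (Fin 6 → ℝ)) : Fin 15 → ℝ := mul22 p.1 p.1 + mul22 p.2 p.2

lemma ev1_single (i : Fin 3) (v : Fin 3 → ℝ) : ev1 (Pi.single i 1) v = v i := by
  fin_cases i <;> simp [ev1]

lemma ev1_lam (i j k : Fin 3) (a b : ℝ) (v : Fin 3 → ℝ) :
    ev1 (lam i j k a b) v = v k - a * v i - b * v j := by
  simp only [lam, ev1_add, ev1_smul, ev1_single]; ring

lemma ev2_quad (i j : Fin 3) (a b c : ℝ) (v : Fin 3 → ℝ) :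
    ev2 (quad i j a b c) v = a * v i ^ 2 + b * (v i * v j) + c * v j ^ 2 := by
  simp only [quad, ev2_add, ev2_smul, ev2_mul11, ev1_single]; ring

lemma ev4_Psi (i j k : Fin 3) (p : Par) (v : Fin 3 → ℝ) :
    ev4 (Psi i j k p) v =
      (p.2.1 0 * v i ^ 2 + p.2.1 1 * (v i * v j) + p.2.1 2 * v j ^ 2) ^ 2
      + (v k - p.1 0 * v i - p.1 1 * v j) * (p.2.2.1 0 * v i + p.2.2.1 1 * v j) *
        (p.2.1 0 * v i ^ 2 + p.2.1 1 * (v i * v j) + p.2.1 2 * v j ^ 2)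
      + (v k - p.1 0 * v i - p.1 1 * v j) ^ 2 * ev2 p.2.2.2 v := by
  simp only [Psi, ev4_add, ev4_mul22, ev2_mul11, ev1_lam, ev2_quad, ev1_add, ev1_smul, ev1_single]
  ring

lemma perm_lemma (q : Fin 6 → ℝ) (i j k : Fin 3) (hij : i ≠ j) (hik : i ≠ k) (hjk : j ≠ k) :
    ∃ q' : Fin 6 → ℝ, (∀ v : Fin 3 → ℝ, ev2 q v = ev2 q' ![v i, v j, v k]) ∧
      ∀ v : Fin 3 → ℂ, ev2 (fun n => (q n : ℂ)) v = ev2 (fun n => (q' n : ℂ)) ![v i, v j, v k] := by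
  let t : Fin 3 → Fin 3 → Fin 6 := ![![0, 1, 2], ![1, 3, 4], ![2, 4, 5]]
  refine ⟨![q (t i i), q (t i j), q (t i k), q (t j j), q (t j k), q (t k k)], fun v => ?_, fun v => ?_⟩
  · fin_cases i <;> fin_cases j <;> (try exact absurd rfl hij) <;> fin_cases k <;>
      (try exact absurd rfl hik) <;> (try exact absurd rfl hjk) <;>
      simp [t, ev2] <;> ring
  · fin_cases i <;> fin_cases j <;> (try exact absurd rfl hij) <;> fin_cases k <;>
      (try exact absurd rfl hik) <;> (try exact absurd rfl hjk) <;>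
      simp [t, ev2] <;> ring

lemma base_lemma (q : Fin 6 → ℝ) (τ : ℂ) (hτ : τ.im ≠ 0) (α β : ℝ)
    (h : ev2 (fun n => (q n : ℂ)) ![τ, 1, α * τ + β] = 0) :
    ∃ a μ ν κ : ℝ, ∀ x y z : ℝ, ev2 q ![x, y, z] =
      a * (x ^ 2 - 2 * τ.re * (x * y) + (τ.re ^ 2 + τ.im ^ 2) * y ^ 2)
      + (z - α * x - β * y) * (μ * x + ν * y) + κ * (z - α * x - β * y) ^ 2 := by
  set A := q 0 + q 2 * α + q 5 * α ^ 2 with hA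
  set B := q 1 + q 2 * β + q 4 * α + 2 * q 5 * α * β with hB
  set C := q 3 + q 4 * β + q 5 * β ^ 2 with hC
  have h' : (A : ℂ) * τ ^ 2 + B * τ + C = 0 := by
    rw [← h]; simp [ev2, hA, hB, hC]; ring
  have hre := congrArg Complex.re h'
  have him := congrArg Complex.im h'
  simp [pow_two] at hre him
  have hB' : B = - (2 * τ.re * A) := by
    apply mul_right_cancel₀ hτ
    linear_combination him
  have hC' : C = (τ.re ^ 2 + τ.im ^ 2) * A := by
    rw [hB'] at hre
    linear_combination hre
  refine ⟨A, q 2 + 2 * q 5 * α, q 4 + 2 * q 5 * β, q 5, fun x y z => ?_⟩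
  have : ev2 q ![x, y, z] = A * x ^ 2 + B * (x * y) + C * y ^ 2
      + (z - α * x - β * y) * ((q 2 + 2 * q 5 * α) * x + (q 4 + 2 * q 5 * β) * y)
      + q 5 * (z - α * x - β * y) ^ 2 := by
    simp [ev2, hA, hB, hC]; ring
  rw [this, hC', hB']; ring

lemma ev2_scale (q : Fin 6 → ℂ) (r : ℂ) (v : Fin 3 → ℂ) :
    ev2 q (fun i => r * v i) = r ^ 2 * ev2 q v := by
  simp [ev2]; ring

lemma bad_lemma (q : Fin 3 → Fin 6 → ℝ) (P : Fin 3 → ℂ)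
    (hq : ∀ n, ev2 (fun m => (q n m : ℂ)) P = 0) (i j k : Fin 3) (hij : i ≠ j) (hik : i ≠ k)
    (hjk : j ≠ k) (hj : P j ≠ 0) (hτ : (P i / P j).im ≠ 0) :
    ∃ p : Par, Phi q = Psi i j k p := by
  set τ := P i / P j with hτd
  set σ := P k / P j with hσd
  set α := σ.im / τ.im with hα
  set β := σ.re - α * τ.re with hβ
  have hσ : σ = α * τ + β := by
    apply Complex.ext
    · simp [hβ]
    · simp [hα]; field_simp
  have H : ∀ n, ∃ a μ ν κ : ℝ, ∀ v : Fin 3 → ℝ, ev2 (q n) v =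
      a * (v i ^ 2 - 2 * τ.re * (v i * v j) + (τ.re ^ 2 + τ.im ^ 2) * v j ^ 2)
      + (v k - α * v i - β * v j) * (μ * v i + ν * v j) + κ * (v k - α * v i - β * v j) ^ 2 := by
    intro n
    obtain ⟨q', h1, h2⟩ := perm_lemma (q n) i j k hij hik hjk
    have h3 : ev2 (fun n => (q' n : ℂ)) ![τ, 1, α * τ + β] = 0 := by
      have e : (fun m => P j * (![τ, 1, α * τ + β] : Fin 3 → ℂ) m) = ![P i, P j, P k] := by
        ext m
        fin_cases m
        · simp [hτd]; field_simp
        · simp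
        · simp [← hσ, hσd]; field_simp
      have := ev2_scale (fun n => (q' n : ℂ)) (P j) ![τ, 1, α * τ + β]
      rw [e, ← h2, hq] at this
      simpa [hj] using this.symm
    obtain ⟨a, μ, ν, κ, h4⟩ := base_lemma q' τ hτ α β h3
    exact ⟨a, μ, ν, κ, fun v => by rw [h1, h4]⟩
  choose a μ ν κ H using H
  -- the residual quadratic form
  let r : Fin 6 → ℝ := ∑ n, ((2 * a n * κ n) • quad i j 1 (-2 * τ.re) (τ.re ^ 2 + τ.im ^ 2)
    + mul11 (μ n • Pi.single i 1 + ν n • Pi.single j 1 + κ n • lam i j k α β)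
      (μ n • Pi.single i 1 + ν n • Pi.single j 1 + κ n • lam i j k α β))
  have hr : ∀ v, ev2 r v = ∑ n, (2 * a n * κ n * (v i ^ 2 - 2 * τ.re * (v i * v j)
      + (τ.re ^ 2 + τ.im ^ 2) * v j ^ 2) +
      (μ n * v i + ν n * v j + κ n * (v k - α * v i - β * v j)) ^ 2) := by
    intro v
    simp only [r, Fin.sum_univ_three, ev2_add, ev2_smul, ev2_quad, ev2_mul11, ev1_add, ev1_smul,
      ev1_single, ev1_lam]
    ring
  set S := a 0 ^ 2 + a 1 ^ 2 + a 2 ^ 2 with hS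
  have hS0 : 0 ≤ S := by positivity
  by_cases h0 : S = 0
  · have a0 : a 0 = 0 := by nlinarith [sq_nonneg (a 0), sq_nonneg (a 1), sq_nonneg (a 2)]
    have a1 : a 1 = 0 := by nlinarith [sq_nonneg (a 0), sq_nonneg (a 1), sq_nonneg (a 2)]
    have a2 : a 2 = 0 := by nlinarith [sq_nonneg (a 0), sq_nonneg (a 1), sq_nonneg (a 2)]
    refine ⟨(![α, β], 0, 0, r), ev4_inj _ _ fun v => ?_⟩
    rw [ev4_Phi, ev4_Psi, hr, Fin.sum_univ_three, H, H, H, a0, a1, a2]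
    simp
    ring
  · set s := Real.sqrt S with hs
    have hs2 : s ^ 2 = S := Real.sq_sqrt hS0
    have hs0 : s ≠ 0 := fun h => h0 (by rw [← hs2, h]; simp)
    refine ⟨(![α, β], ![s, -2 * τ.re * s, (τ.re ^ 2 + τ.im ^ 2) * s],
      ![2 * (a 0 * μ 0 + a 1 * μ 1 + a 2 * μ 2) / s, 2 * (a 0 * ν 0 + a 1 * ν 1 + a 2 * ν 2) / s], r),
      ev4_inj _ _ fun v => ?_⟩
    rw [ev4_Phi, ev4_Psi, hr, Fin.sum_univ_three, H, H, H]
    simp only [Matrix.cons_val_zero, Matrix.cons_val_one, Matrix.cons_val]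
    generalize v k - α * v i - β * v j = L
    have hT : s * v i ^ 2 + -2 * τ.re * s * (v i * v j) + (τ.re ^ 2 + τ.im ^ 2) * s * v j ^ 2
      = s * (v i ^ 2 - 2 * τ.re * (v i * v j) + (τ.re ^ 2 + τ.im ^ 2) * v j ^ 2) := by ring
    rw [hT]
    generalize (v i ^ 2 - 2 * τ.re * (v i * v j) + (τ.re ^ 2 + τ.im ^ 2) * v j ^ 2) = T
    rw [hS] at hs2
    field_simp
    linear_combination (-T ^ 2) * hs2

lemma dep_lemma (q : Fin 3 → Fin 6 → ℝ) (c : Fin 3 → ℝ)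
    (hc : c 0 • q 0 + c 1 • q 1 + c 2 • q 2 = 0) (hc0 : c ≠ 0) :
    ∃ p, Phi q = Psi2 p := by
  obtain ⟨k, hk⟩ : ∃ k, c k ≠ 0 := by
    by_contra! h
    exact hc0 (funext h)
  obtain ⟨a, b, hab⟩ : ∃ a b : ℝ, ∀ v, ev2 (q k) v = a * ev2 (q (k + 1)) v + b * ev2 (q (k + 2)) v := by
    refine ⟨- c (k + 1) / c k, - c (k + 2) / c k, fun v => ?_⟩
    have h : ev2 (c 0 • q 0 + c 1 • q 1 + c 2 • q 2) v = 0 := by rw [hc]; simp [ev2]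
    rw [ev2_add, ev2_add, ev2_smul, ev2_smul, ev2_smul] at h
    have h' : c k * ev2 (q k) v + c (k + 1) * ev2 (q (k + 1)) v + c (k + 2) * ev2 (q (k + 2)) v = 0 := by
      rw [← h]; fin_cases k <;> simp <;> ring
    field_simp
    linear_combination h'
  have hP : ∀ v, ev4 (Phi q) v = ev2 (q k) v ^ 2 + ev2 (q (k + 1)) v ^ 2 + ev2 (q (k + 2)) v ^ 2 := by
    intro v
    rw [ev4_Phi]; fin_cases k <;> simp <;> ring
  set s := Real.sqrt (1 + a ^ 2) with hs
  have hs2 : s ^ 2 = 1 + a ^ 2 := Real.sq_sqrt (by positivity)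
  have hs0 : s ≠ 0 := fun h => by rw [h] at hs2; nlinarith
  set u := Real.sqrt (1 + a ^ 2 + b ^ 2) with hu
  have hu2 : u ^ 2 = 1 + a ^ 2 + b ^ 2 := Real.sq_sqrt (by positivity)
  refine ⟨(s • q (k + 1) + (a * b / s) • q (k + 2), (u / s) • q (k + 2)), ev4_inj _ _ fun v => ?_⟩
  rw [hP, hab, Psi2]
  simp only [ev4_add, ev4_mul22, ev2_add, ev2_smul]
  field_simp
  generalize ev2 (q (k + 1)) v = X
  generalize ev2 (q (k + 2)) v = Y
  have e4 : s ^ 4 = (1 + a ^ 2) ^ 2 := by rw [← hs2]; ring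
  ring_nf
  simp only [e4, hs2, hu2]
  ring

end HTQ

namespace HTQ
open Set Filter Topology

lemma contDiff_mul22 {E : Type*} [NormedAddCommGroup E] [NormedSpace ℝ E]
    {f g : E → Fin 6 → ℝ} (hf : ContDiff ℝ 1 f) (hg : ContDiff ℝ 1 g) :
    ContDiff ℝ 1 (fun x => mul22 (f x) (g x)) := by
  have hf' := contDiff_pi.1 hf
  have hg' := contDiff_pi.1 hg
  refine contDiff_pi.2 fun n => ?_
  fin_cases n <;> simp [mul22] <;> fun_prop

lemma contDiff_mul11 {E : Type*} [NormedAddCommGroup E] [NormedSpace ℝ E]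
    {f g : E → Fin 3 → ℝ} (hf : ContDiff ℝ 1 f) (hg : ContDiff ℝ 1 g) :
    ContDiff ℝ 1 (fun x => mul11 (f x) (g x)) := by
  have hf' := contDiff_pi.1 hf
  have hg' := contDiff_pi.1 hg
  refine contDiff_pi.2 fun n => ?_
  fin_cases n <;> simp [mul11] <;> fun_prop

lemma contDiff_Phi : ContDiff ℝ 1 Phi := by
  unfold Phi
  have : ∀ i : Fin 3, ContDiff ℝ 1 (fun q : Fin 3 → Fin 6 → ℝ => q i) := fun i => by fun_prop
  exact ((contDiff_mul22 (this 0) (this 0)).add (contDiff_mul22 (this 1) (this 1))).add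
    (contDiff_mul22 (this 2) (this 2))

lemma contDiff_Psi2 : ContDiff ℝ 1 Psi2 := by
  unfold Psi2
  exact (contDiff_mul22 contDiff_fst contDiff_fst).add (contDiff_mul22 contDiff_snd contDiff_snd)

lemma contDiff_Psi (i j k : Fin 3) : ContDiff ℝ 1 (Psi i j k) := by
  have h1 : ContDiff ℝ 1 (fun p : Par => lam i j k (p.1 0) (p.1 1)) := by
    unfold lam; fun_prop
  have h2 : ContDiff ℝ 1 (fun p : Par => quad i j (p.2.1 0) (p.2.1 1) (p.2.1 2)) := by
    unfold quad; fun_prop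
  have h3 : ContDiff ℝ 1 (fun p : Par => (p.2.2.1 0 • Pi.single i 1 + p.2.2.1 1 • Pi.single j 1 : Fin 3 → ℝ)) := by
    fun_prop
  have h4 : ContDiff ℝ 1 (fun p : Par => p.2.2.2) := by fun_prop
  unfold Psi
  exact ((contDiff_mul22 h2 h2).add (contDiff_mul22 (contDiff_mul11 h1 h3) h2)).add
    (contDiff_mul22 (contDiff_mul11 h1 h1) h4)

lemma Phi_open (q : Fin 3 → Fin 6 → ℝ)
    (h : ∀ g : Fin 15 → ℝ, ∃ h : Fin 3 → Fin 6 → ℝ, g = ∑ i, mul22 (q i) (h i)) :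
    range Phi ∈ 𝓝 (Phi q) := by
  have hs : HasStrictFDerivAt Phi (fderiv ℝ Phi q) q :=
    contDiff_Phi.contDiffAt.hasStrictFDerivAt (by norm_num)
  have hd : ∀ h, fderiv ℝ Phi q h = (2 : ℝ) • ∑ i, mul22 (q i) (h i) := by
    intro h
    have h1 : HasDerivAt (fun t : ℝ => Phi (q + t • h)) (fderiv ℝ Phi q h) 0 :=
      hs.hasFDerivAt.hasLineDerivAt h
    have h2 : HasDerivAt (fun t : ℝ => Phi (q + t • h)) ((2 : ℝ) • ∑ i, mul22 (q i) (h i)) 0 := by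
      have e : (fun t : ℝ => Phi (q + t • h)) = fun t : ℝ => Phi q +
          (t • ((2 : ℝ) • ∑ i, mul22 (q i) (h i)) + (t ^ 2) • Phi h) := by
        funext t
        refine ev4_inj _ _ fun v => ?_
        simp only [Fin.sum_univ_three, ev4_add, ev4_smul, ev4_mul22, ev4_Phi, Pi.add_apply, Pi.smul_apply,
          ev2_add, ev2_smul]
        ring
      rw [e]
      have := (((hasDerivAt_id (0 : ℝ)).smul_const ((2 : ℝ) • ∑ i, mul22 (q i) (h i))).add
        ((hasDerivAt_pow 2 (0 : ℝ)).smul_const (Phi h))).const_add (Phi q)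
      exact this.congr_deriv (by simp)
    exact h1.unique h2
  have hr : (fderiv ℝ Phi q).range = ⊤ := by
    rw [LinearMap.range_eq_top]
    intro g
    obtain ⟨k, hk⟩ := h ((1 / 2 : ℝ) • g)
    refine ⟨k, ?_⟩
    have := hd k
    rw [← hk] at this
    simpa using this
  rw [← hs.map_nhds_eq_of_surj hr]
  exact range_mem_map

lemma Phi_bound (q : Fin 3 → Fin 6 → ℝ) (M : ℝ) (hM : ‖Phi q‖ ≤ M) : ‖q‖ ≤ 3 * M + 1 := by
  have hM0 : 0 ≤ M := (norm_nonneg _).trans hM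
  have hc : ∀ n, Phi q n ≤ M := fun n =>
    (le_abs_self _).trans ((norm_le_pi_norm (Phi q) n).trans hM)
  have h0 := hc 0
  have h3 := hc 3
  have h5 := hc 5
  have h10 := hc 10
  have h12 := hc 12
  have h14 := hc 14
  simp [Phi, mul22] at h0 h3 h5 h10 h12 h14
  have key : ∀ i j, q i j ^ 2 ≤ 3 * M := by
    have sum3 : ∀ a b c : ℝ, a ^ 2 + b ^ 2 + c ^ 2 ≤ 3 * M → a ^ 2 ≤ 3 * M ∧ b ^ 2 ≤ 3 * M ∧ c ^ 2 ≤ 3 * M :=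
      fun a b c h => ⟨by linarith [sq_nonneg b, sq_nonneg c], by linarith [sq_nonneg a, sq_nonneg c],
        by linarith [sq_nonneg b, sq_nonneg a]⟩
    have g0 := sum3 (q 0 0) (q 1 0) (q 2 0) (by linarith)
    have g3 := sum3 (q 0 3) (q 1 3) (q 2 3) (by linarith)
    have g5 := sum3 (q 0 5) (q 1 5) (q 2 5) (by linarith)
    have g1 := sum3 (q 0 1) (q 1 1) (q 2 1) (by
      linarith [sq_nonneg (q 0 0 + q 0 3), sq_nonneg (q 1 0 + q 1 3), sq_nonneg (q 2 0 + q 2 3)])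
    have g2 := sum3 (q 0 2) (q 1 2) (q 2 2) (by
      linarith [sq_nonneg (q 0 0 + q 0 5), sq_nonneg (q 1 0 + q 1 5), sq_nonneg (q 2 0 + q 2 5)])
    have g4 := sum3 (q 0 4) (q 1 4) (q 2 4) (by
      linarith [sq_nonneg (q 0 3 + q 0 5), sq_nonneg (q 1 3 + q 1 5), sq_nonneg (q 2 3 + q 2 5)])
    intro i j
    fin_cases i <;> fin_cases j <;> simp <;> tauto
  refine (pi_norm_le_iff_of_nonneg (by positivity)).2 fun i =>
    (pi_norm_le_iff_of_nonneg (by positivity)).2 fun j => ?_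
  rw [Real.norm_eq_abs]
  refine abs_le_of_sq_le_sq ?_ (by positivity)
  nlinarith [key i j]

lemma Phi_closed : IsClosed (range Phi) := by
  apply IsSeqClosed.isClosed
  intro x c hx hc
  choose q hq using hx
  obtain ⟨M, hM⟩ := (Metric.isBounded_range_of_tendsto x hc).exists_norm_le
  have hb : ∀ n, q n ∈ Metric.closedBall (0 : Fin 3 → Fin 6 → ℝ) (3 * M + 1) := fun n => by
    rw [mem_closedBall_zero_iff]
    exact Phi_bound _ _ (by rw [hq]; exact hM _ (mem_range_self n))
  obtain ⟨a, -, φ, hφ, ha⟩ := (isCompact_closedBall _ _).tendsto_subseq hb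
  refine ⟨a, ?_⟩
  have h1 := (contDiff_Phi.continuous.tendsto a).comp ha
  have h2 := hc.comp hφ.tendsto_atTop
  refine tendsto_nhds_unique h1 ?_
  convert h2 using 1
  funext n
  simp [hq]

/-- `x⁴ + y⁴ + z⁴` as a sum of three squares. -/
def q0 : Fin 3 → Fin 6 → ℝ := ![![1, 0, 0, 0, 0, 0], ![0, 0, 0, 1, 0, 0], ![0, 0, 0, 0, 0, 1]]

lemma q0_interior : Phi q0 ∈ interior (range Phi) := by
  rw [mem_interior_iff_mem_nhds]
  refine Phi_open _ fun g => ?_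
  refine ⟨![![g 0, g 1, g 2, g 3, g 4, g 5], ![0, g 6, g 7, g 10, g 11, g 12], ![0, g 8, g 9, 0, g 13, g 14]],
    ev4_inj _ _ fun v => ?_⟩
  simp [Fin.sum_univ_three, q0, ev4_add, ev4_mul22, ev2]
  simp [ev4]
  ring

lemma ev4_q0 (v : Fin 3 → ℝ) : ev4 (Phi q0) v = v 0 ^ 4 + v 1 ^ 4 + v 2 ^ 4 := by
  simp [ev4_Phi, q0, ev2]; ring

lemma real_zero (q : Fin 6 → ℝ) (P : Fin 3 → ℂ) (j : Fin 3) (hj : P j ≠ 0)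
    (hr : ∀ i, (P i / P j).im = 0) (h : ev2 (fun m => (q m : ℂ)) P = 0) :
    ev2 q (fun i => (P i / P j).re) = 0 := by
  have e : P = fun i => P j * (((P i / P j).re : ℝ) : ℂ) := by
    funext i
    have : (((P i / P j).re : ℝ) : ℂ) = P i / P j := Complex.ext (by simp) (by simp [hr i])
    rw [this]; field_simp
  rw [e, ev2_scale] at h
  have h' : ev2 (fun m => (q m : ℂ)) (fun i => (((P i / P j).re : ℝ) : ℂ)) = 0 := by
    simpa [hj] using h
  have e2 : ev2 (fun m => (q m : ℂ)) (fun i => (((P i / P j).re : ℝ) : ℂ)) =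
    ((ev2 q (fun i => (P i / P j).re) : ℝ) : ℂ) := by simp [ev2]
  rw [e2] at h'
  exact_mod_cast h'

lemma open_at (q : Fin 3 → Fin 6 → ℝ) (hpos : ∀ v : Fin 3 → ℝ, v ≠ 0 → 0 < ev4 (Phi q) v)
    (h1 : ∀ i j k p, Phi q ≠ Psi i j k p) (h2 : ∀ p, Phi q ≠ Psi2 p) :
    range Phi ∈ 𝓝 (Phi q) := by
  refine Phi_open q (surj_real q ?_ ?_)
  · intro c hc
    by_contra h0
    obtain ⟨p, hp⟩ := dep_lemma q c hc h0
    exact h2 p hp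
  · intro P hP
    by_contra! h
    obtain ⟨j, hj⟩ : ∃ j, P j ≠ 0 := by
      by_contra! h
      exact hP (funext h)
    by_cases hr : ∀ i, (P i / P j).im = 0
    · have hz := fun n => real_zero (q n) P j hj hr (h n)
      have := hpos (fun i => (P i / P j).re) (by
        intro h0
        have := congrFun h0 j
        simp [hj] at this)
      rw [ev4_Phi, hz, hz, hz] at this
      simp at this
    · push Not at hr
      obtain ⟨i, hi⟩ := hr
      have hij : i ≠ j := by
        rintro rfl
        simp [hj] at hi
      obtain ⟨k, hik, hjk⟩ : ∃ k, i ≠ k ∧ j ≠ k :=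
        (by decide : ∀ i j : Fin 3, ∃ k, i ≠ k ∧ j ≠ k) i j
      obtain ⟨p, hp⟩ := bad_lemma q P h i j k hij hik hjk hj hi
      exact h1 i j k p hp

lemma exists_start (f : Fin 15 → ℝ) : ∃ s ∈ interior (range Phi),
    (∀ i j k p (u : ℝ), s ≠ f + u • (Psi i j k p - f)) ∧ (∀ p (u : ℝ), s ≠ f + u • (Psi2 p - f)) := by
  let B : Set (Fin 15 → ℝ) :=
    (⋃ t : Fin 3 × Fin 3 × Fin 3, range (fun x : ℝ × Par => f + x.1 • (Psi t.1 t.2.1 t.2.2 x.2 - f)))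
    ∪ range (fun x : ℝ × ((Fin 6 → ℝ) × (Fin 6 → ℝ)) => f + x.1 • (Psi2 x.2 - f))
  have hB : dimH B < Module.finrank ℝ (Fin 15 → ℝ) := by
    rw [dimH_union, dimH_iUnion]
    have h1 : ∀ t : Fin 3 × Fin 3 × Fin 3,
        dimH (range (fun x : ℝ × Par => f + x.1 • (Psi t.1 t.2.1 t.2.2 x.2 - f))) ≤ 14 := by
      intro t
      have : ContDiff ℝ 1 (fun x : ℝ × Par => f + x.1 • (Psi t.1 t.2.1 t.2.2 x.2 - f)) :=
        contDiff_const.add (contDiff_fst.smul (((contDiff_Psi _ _ _).comp contDiff_snd).sub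
          contDiff_const))
      refine this.dimH_range_le.trans (le_of_eq ?_)
      simp only [Par, Module.finrank_prod, Module.finrank_fin_fun, Module.finrank_self]
      norm_num
    have h2 : dimH (range (fun x : ℝ × ((Fin 6 → ℝ) × (Fin 6 → ℝ)) => f + x.1 • (Psi2 x.2 - f))) ≤ 14 := by
      have : ContDiff ℝ 1 (fun x : ℝ × ((Fin 6 → ℝ) × (Fin 6 → ℝ)) => f + x.1 • (Psi2 x.2 - f)) :=
        contDiff_const.add (contDiff_fst.smul ((contDiff_Psi2.comp contDiff_snd).sub
          contDiff_const))
      refine this.dimH_range_le.trans ?_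
      simp only [Module.finrank_prod, Module.finrank_fin_fun, Module.finrank_self]
      norm_num
    refine lt_of_le_of_lt (max_le (iSup_le h1) h2) ?_
    simp only [Module.finrank_fin_fun]
    norm_num
  obtain ⟨s, hs, hsB⟩ := (dense_compl_of_dimH_lt_finrank hB).inter_open_nonempty _ isOpen_interior
    ⟨_, q0_interior⟩
  refine ⟨s, hs, fun i j k p u h => hsB (Or.inl ?_), fun p u h => hsB (Or.inr ?_)⟩
  · exact mem_iUnion.2 ⟨(i, j, k), (u, p), h.symm⟩
  · exact ⟨(u, p), h.symm⟩

lemma main_pos (f : Fin 15 → ℝ) (hf : ∀ v : Fin 3 → ℝ, v ≠ 0 → 0 < ev4 f v) : f ∈ range Phi := by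
  obtain ⟨s, hs, hs1, hs2⟩ := exists_start f
  let γ : ℝ → Fin 15 → ℝ := fun t => s + t • (f - s)
  have hγ : Continuous γ := by fun_prop
  have hsub : Icc (0 : ℝ) 1 ⊆ γ ⁻¹' range Phi := by
    refine IsClosed.Icc_subset_of_forall_exists_gt ((Phi_closed.preimage hγ).inter isClosed_Icc) ?_ ?_
    · simpa [γ] using interior_subset hs
    · rintro t ⟨htS, ht0, ht1⟩ y hy
      have hn : range Phi ∈ 𝓝 (γ t) := by
        rcases ht0.eq_or_lt with rfl | ht0
        · simpa [γ] using mem_interior_iff_mem_nhds.1 hs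
        · obtain ⟨q, hq⟩ := htS
          rw [← hq]
          obtain ⟨qs, hqs⟩ := interior_subset hs
          have line : ∀ g, Phi q = g → s = f + (1 - t)⁻¹ • (g - f) := by
            rintro g rfl
            have : 1 - t ≠ 0 := by linarith
            rw [hq]
            ext n
            simp [γ]
            field_simp
            ring
          refine open_at q (fun v hv => ?_) (fun i j k p h => hs1 i j k p _ (line _ h))
            (fun p h => hs2 p _ (line _ h))
          rw [hq]
          have e : ev4 (γ t) v = (1 - t) * ev4 s v + t * ev4 f v := by
            simp only [γ, ev4_add, ev4_smul, ev4_sub]; ring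
          have e2 : 0 ≤ ev4 s v := by rw [← hqs, ev4_Phi]; positivity
          rw [e]
          have := mul_pos ht0 (hf v hv)
          have := mul_nonneg (sub_nonneg.2 ht1.le) e2
          linarith
      have h1 : γ ⁻¹' range Phi ∈ 𝓝[>] t := nhdsWithin_le_nhds (hγ.continuousAt hn)
      exact Filter.nonempty_of_mem (inter_mem h1 (Ioc_mem_nhdsGT hy))
  have := hsub (right_mem_Icc.2 zero_le_one)
  simpa [γ] using this

lemma main_coeff (f : Fin 15 → ℝ) (hf : ∀ v : Fin 3 → ℝ, 0 ≤ ev4 f v) : f ∈ range Phi := by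
  have hlim : Tendsto (fun n : ℕ => f + (1 / ((n : ℝ) + 1)) • Phi q0) atTop (𝓝 f) := by
    have := (tendsto_one_div_add_atTop_nhds_zero_nat (𝕜 := ℝ)).smul_const (Phi q0)
    simpa using this.const_add f
  refine Phi_closed.mem_of_tendsto hlim (Eventually.of_forall fun n => main_pos _ fun v hv => ?_)
  rw [ev4_add, ev4_smul, ev4_q0]
  have h1 : (0 : ℝ) < 1 / ((n : ℝ) + 1) := by positivity
  have h2 : 0 < v 0 ^ 4 + v 1 ^ 4 + v 2 ^ 4 := by
    obtain ⟨j, hj⟩ : ∃ j, v j ≠ 0 := by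
      by_contra! h
      exact hv (funext h)
    have hp : 0 < v j ^ 4 := by positivity
    have e0 : 0 ≤ v 0 ^ 4 := by positivity
    have e1 : 0 ≤ v 1 ^ 4 := by positivity
    have e2 : 0 ≤ v 2 ^ 4 := by positivity
    fin_cases j <;> simp at hp <;> linarith
  have := mul_pos h1 h2
  linarith [hf v]

/-! ### Translation to polynomials -/

open MvPolynomial

lemma exists_coeff (p : MvPolynomial (Fin 3) ℝ) (hp : p.IsHomogeneous 4) :
    ∃ c : Fin 15 → ℝ, p = ev4 (fun n => C (c n)) X := by
  rw [p.as_sum]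
  have : ∀ T : Finset (Fin 3 →₀ ℕ), T ⊆ p.support →
      ∃ c : Fin 15 → ℝ, ∑ d ∈ T, monomial d (coeff d p) = ev4 (fun n => C (c n)) X := by
    intro T
    induction T using Finset.induction_on with
    | empty => exact fun _ => ⟨0, by simp [ev4]⟩
    | insert d T hd ih =>
      intro hT
      obtain ⟨c, hc⟩ := ih (fun x hx => hT (Finset.mem_insert_of_mem hx))
      have hdeg : d 0 + d 1 + d 2 = 4 := by
        have := hp (mem_support_iff.1 (hT (Finset.mem_insert_self d T)))
        rw [Finsupp.weight_apply, Finsupp.sum_fintype _ _ (by simp)] at this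
        simpa [Fin.sum_univ_three] using this
      have hm : ∃ b : Fin 15 → ℝ, monomial d (coeff d p) = ev4 (fun n => C (b n)) X := by
        refine ⟨fun m => if (m : ℕ) = (4 - d 0) * (5 - d 0) / 2 + d 2 then coeff d p else 0, ?_⟩
        rw [monomial_eq, Finsupp.prod_fintype _ _ (by simp), Fin.prod_univ_three]
        generalize coeff d p = a
        generalize d 0 = x at hdeg ⊢
        generalize d 1 = y at hdeg ⊢
        generalize d 2 = z at hdeg ⊢
        have hz : z = 4 - x - y := by omega
        have hx : x ≤ 4 := by omega
        have hy : y ≤ 4 - x := by omega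
        subst hz
        interval_cases x <;> interval_cases y <;> simp [ev4] <;> ring
      obtain ⟨b, hb⟩ := hm
      refine ⟨b + c, ?_⟩
      rw [Finset.sum_insert hd, hb, hc, ← ev4_add]
      congr 1
      funext n
      simp
  exact this _ subset_rfl

lemma hom_ev2 (q : Fin 6 → ℝ) :
    (ev2 (fun n => C (q n)) X : MvPolynomial (Fin 3) ℝ).IsHomogeneous 2 := by
  have h1 : ∀ (a : ℝ) (i j : Fin 3), (C a * (X i * X j) : MvPolynomial (Fin 3) ℝ).IsHomogeneous 2 := by
    intro a i j
    simpa using (isHomogeneous_C (Fin 3) a).mul ((isHomogeneous_X ℝ i).mul (isHomogeneous_X ℝ j))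
  simp only [ev2, pow_two]
  exact (((((h1 _ _ _).add (h1 _ _ _)).add (h1 _ _ _)).add (h1 _ _ _)).add (h1 _ _ _)).add (h1 _ _ _)

lemma map_mul22 {K L : Type*} [CommRing K] [CommRing L] (φ : K →+* L) (a b : Fin 6 → K) :
    (fun n => φ (mul22 a b n)) = mul22 (fun n => φ (a n)) (fun n => φ (b n)) := by
  funext n
  fin_cases n <;> simp [mul22]

lemma C_mul22 (a b : Fin 6 → ℝ) : (fun n => (C (mul22 a b n) : MvPolynomial (Fin 3) ℝ)) =
    mul22 (fun n => C (a n)) (fun n => C (b n)) :=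
  map_mul22 C a b

lemma ev4_C_Phi (q : Fin 3 → Fin 6 → ℝ) :
    (ev4 (fun n => C (Phi q n)) X : MvPolynomial (Fin 3) ℝ) =
      ev2 (fun n => C (q 0 n)) X ^ 2 + ev2 (fun n => C (q 1 n)) X ^ 2
        + ev2 (fun n => C (q 2 n)) X ^ 2 := by
  have : (fun n => (C (Phi q n) : MvPolynomial (Fin 3) ℝ)) =
      (fun n => C (mul22 (q 0) (q 0) n)) + (fun n => C (mul22 (q 1) (q 1) n))
        + (fun n => C (mul22 (q 2) (q 2) n)) := by
    funext n
    simp only [Phi, Pi.add_apply, C_add]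
  rw [this, ev4_add, ev4_add, C_mul22, C_mul22, C_mul22, ev4_mul22, ev4_mul22, ev4_mul22]
  simp only [pow_two]

end HTQ

/-- Hilbert's ternary quartic theorem: every nonnegative ternary quartic is a
sum of three squares of homogeneous quadratic polynomials. -/
theorem hilbert_ternary_quartic
    (p : MvPolynomial (Fin 3) ℝ) (hhom : p.IsHomogeneous 4)
    (hpos : ∀ x : Fin 3 → ℝ, 0 ≤ MvPolynomial.eval x p) :
    ∃ q₁ q₂ q₃ : MvPolynomial (Fin 3) ℝ,
      q₁.IsHomogeneous 2 ∧ q₂.IsHomogeneous 2 ∧ q₃.IsHomogeneous 2 ∧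
      p = q₁ ^ 2 + q₂ ^ 2 + q₃ ^ 2 := by
  obtain ⟨c, rfl⟩ := HTQ.exists_coeff p hhom
  obtain ⟨q, rfl⟩ := HTQ.main_coeff c (fun v => by
    have := hpos v
    simpa [HTQ.ev4] using this)
  exact ⟨_, _, _, HTQ.hom_ev2 (q 0), HTQ.hom_ev2 (q 1), HTQ.hom_ev2 (q 2), HTQ.ev4_C_Phi q⟩
end

section
/- Every nonnegative ternary quartic is a sum of at most four squares of homogeneous quadratic polynomials: if p(x,y,z) is a homogeneous real polynomial of degree 4 in three variables satisfying p(x,y,z) ≥ 0 for all real x, y, z, then there exist four homogeneous quadratic polynomials q_1, q_2, q_3, q_4 in x, y, z with real coefficients such that p = q_1^2 + q_2^2 + q_3^2 + q_4^2. -/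
open Polynomial in
lemma tq_nonneg_of_mul (N G : ℝ[X]) (hN0 : N ≠ 0) (hN : ∀ t, 0 ≤ N.eval t)
    (h : ∀ t, 0 ≤ (N * G).eval t) (t : ℝ) : 0 ≤ G.eval t := by
  by_contra hlt
  push Not at hlt
  have hopen : IsOpen {s : ℝ | G.eval s < 0} := isOpen_lt G.continuous continuous_const
  have hinf : {s : ℝ | G.eval s < 0}.Infinite :=
    infinite_of_mem_nhds t (hopen.mem_nhds hlt)
  apply hN0
  apply Polynomial.eq_zero_of_infinite_isRoot
  refine hinf.mono ?_
  intro s hs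
  have h1 := h s
  rw [eval_mul] at h1
  have h2 := hN s
  simp only [Set.mem_ofPred_eq] at hs
  show N.eval s = 0
  nlinarith

open Polynomial in
lemma tq_factor (F : ℝ[X]) (hF : ∀ t, 0 ≤ F.eval t) (hd : 0 < F.natDegree) :
    ∃ (a b : ℝ) (G : ℝ[X]), F = ((X - C a) ^ 2 + C (b ^ 2)) * G := by
  obtain ⟨z, hz⟩ := Complex.exists_root (f := F.map (algebraMap ℝ ℂ)) (by
    rw [degree_map]; exact natDegree_pos_iff_degree_pos.mp hd)
  have hz' : aeval z F = 0 := by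
    rw [IsRoot, eval_map_algebraMap] at hz; exact hz
  by_cases him : z.im = 0
  · have hzr : z = ((z.re : ℝ) : ℂ) := by apply Complex.ext <;> simp [him]
    have hr : F.eval z.re = 0 := by
      rw [hzr] at hz'
      have : aeval (algebraMap ℝ ℂ z.re) F = 0 := hz'
      rw [aeval_algebraMap_apply] at this
      simpa using this
    obtain ⟨H, hH⟩ := dvd_iff_isRoot.mpr hr
    have hmin : IsLocalMin (fun t => F.eval t) z.re := by
      refine Filter.Eventually.of_forall fun t => ?_
      show F.eval z.re ≤ F.eval t
      rw [hr]; exact hF t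
    have hder := hmin.hasDerivAt_eq_zero (F.hasDerivAt z.re)
    have hH0 : H.eval z.re = 0 := by
      rw [hH] at hder
      simpa using hder
    obtain ⟨G, hG⟩ := dvd_iff_isRoot.mpr hH0
    refine ⟨z.re, 0, G, ?_⟩
    rw [hH, hG]; simp; ring
  · obtain ⟨G, hG⟩ := Polynomial.quadratic_dvd_of_aeval_eq_zero_im_ne_zero F hz' him
    refine ⟨z.re, z.im, G, ?_⟩
    rw [hG, Complex.sq_norm, Complex.normSq_apply]
    simp only [C_mul, C_add, C_pow]
    have : (C 2 : ℝ[X]) = 2 := rfl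
    rw [this]; ring

open Polynomial in
lemma tq_norm (N : ℝ[X])
    (hN : ∀ a b : ℝ, ∃ T m : ℝ[X], (X - C a) ^ 2 + C (b ^ 2) = T ^ 2 + N * m ^ 2) :
    ∀ (n : ℕ) (F : ℝ[X]), F.natDegree ≤ n → (∀ t, 0 ≤ F.eval t) →
      ∃ T m : ℝ[X], F = T ^ 2 + N * m ^ 2 := by
  intro n
  have hconst : ∀ F : ℝ[X], F.natDegree = 0 → (∀ t, 0 ≤ F.eval t) →
      ∃ T m : ℝ[X], F = T ^ 2 + N * m ^ 2 := by
    intro F h0 hF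
    obtain ⟨c, rfl⟩ := natDegree_eq_zero.mp h0
    have hc : 0 ≤ c := by simpa using hF 0
    refine ⟨C (Real.sqrt c), 0, ?_⟩
    rw [← C_pow, Real.sq_sqrt hc]; simp
  induction n with
  | zero => intro F h; exact hconst F (by omega)
  | succ n ih =>
    intro F h hF
    by_cases h0 : F.natDegree = 0
    · exact hconst F h0 hF
    obtain ⟨a, b, G, hG⟩ := tq_factor F hF (by omega)
    have hmon : ((X - C a) ^ 2 + C (b ^ 2) : ℝ[X]).natDegree = 2 := by
      compute_degree!
    have hne : ((X - C a) ^ 2 + C (b ^ 2) : ℝ[X]) ≠ 0 := by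
      intro h; rw [h] at hmon; simp at hmon
    have hG0 : G ≠ 0 := by rintro rfl; simp [hG] at h0
    have hdeg : F.natDegree = 2 + G.natDegree := by
      rw [hG, natDegree_mul hne hG0, hmon]
    have hGn : ∀ t, 0 ≤ G.eval t := by
      apply tq_nonneg_of_mul _ G hne
      · intro t; simp; positivity
      · rw [← hG]; exact hF
    obtain ⟨T1, m1, h1⟩ := ih G (by omega) hGn
    obtain ⟨T2, m2, h2⟩ := hN a b
    refine ⟨T1 * T2 - N * m1 * m2, T1 * m2 + T2 * m1, ?_⟩
    rw [hG, h1, h2]; ring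

open Polynomial in
lemma tq_two_squares (F : ℝ[X]) (hF : ∀ t, 0 ≤ F.eval t) :
    ∃ A B : ℝ[X], F = A ^ 2 + B ^ 2 := by
  obtain ⟨T, m, h⟩ := tq_norm 1 (fun a b => ⟨X - C a, C b, by simp⟩) F.natDegree F le_rfl hF
  exact ⟨T, m, by simpa using h⟩

open Polynomial in
lemma tq_pencil (α β γ : ℝ) (hα : 0 < α) (hγ : 0 < γ) (a b : ℝ) :
    ∃ T m : ℝ[X], (X - C a) ^ 2 + C (b ^ 2) =
      T ^ 2 + (C α * ((X - C β) ^ 2 + C (γ ^ 2))) * m ^ 2 := by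
  have hk : 0 < β ^ 2 + γ ^ 2 := by positivity
  set M := min 1 ((a ^ 2 + b ^ 2) / (β ^ 2 + γ ^ 2)) with hM
  have hM0 : 0 ≤ M := le_min zero_le_one (by positivity)
  let f : ℝ → ℝ := fun l => (1 - l) * (a ^ 2 + b ^ 2 - l * (β ^ 2 + γ ^ 2)) - (a - l * β) ^ 2
  have hfM : f M ≤ 0 := by
    have : (1 - M) * (a ^ 2 + b ^ 2 - M * (β ^ 2 + γ ^ 2)) = 0 := by
      rcases min_choice 1 ((a ^ 2 + b ^ 2) / (β ^ 2 + γ ^ 2)) with h | h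
      · rw [hM, h]; ring
      · rw [hM, h]; field_simp; ring
    simp only [f, this]
    nlinarith [sq_nonneg (a - M * β)]
  have hf0 : 0 ≤ f 0 := by simp only [f]; nlinarith [sq_nonneg b]
  have hcont : ContinuousOn f (Set.Icc 0 M) := by
    apply Continuous.continuousOn; fun_prop
  obtain ⟨l, ⟨hl0, hlM⟩, hl⟩ := intermediate_value_Icc' hM0 hcont ⟨hfM, hf0⟩
  have hl1 : 0 ≤ 1 - l := by
    have : M ≤ 1 := min_le_left _ _
    linarith
  have hl2 : 0 ≤ a ^ 2 + b ^ 2 - l * (β ^ 2 + γ ^ 2) := by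
    have : M ≤ (a ^ 2 + b ^ 2) / (β ^ 2 + γ ^ 2) := min_le_right _ _
    have := hlM.trans this
    rw [le_div_iff₀ hk] at this
    linarith
  have hprod : (a - l * β) ^ 2 = (1 - l) * (a ^ 2 + b ^ 2 - l * (β ^ 2 + γ ^ 2)) := by
    simp only [f] at hl; linarith
  have hsq : ∃ u v : ℝ, u ^ 2 = 1 - l ∧ v ^ 2 = a ^ 2 + b ^ 2 - l * (β ^ 2 + γ ^ 2) ∧
      u * v = - (a - l * β) := by
    have e1 := Real.sq_sqrt hl1
    have e2 := Real.sq_sqrt hl2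
    have : (Real.sqrt (1 - l) * Real.sqrt (a ^ 2 + b ^ 2 - l * (β ^ 2 + γ ^ 2))) ^ 2
        = (a - l * β) ^ 2 := by rw [mul_pow, e1, e2, hprod]
    rcases sq_eq_sq_iff_eq_or_eq_neg.mp this with h | h
    · exact ⟨_, -Real.sqrt (a ^ 2 + b ^ 2 - l * (β ^ 2 + γ ^ 2)), e1, by rw [neg_sq, e2],
        by rw [mul_neg, h]⟩
    · exact ⟨_, _, e1, e2, h⟩
  obtain ⟨u, v, hu, hv, huv⟩ := hsq
  refine ⟨C u * X + C v, C (Real.sqrt (l / α)), ?_⟩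
  apply Polynomial.funext
  intro t
  have e3 : α * Real.sqrt (l / α) ^ 2 = l := by
    rw [Real.sq_sqrt (by positivity)]; field_simp
  simp only [eval_add, eval_pow, eval_sub, eval_X, eval_C, eval_mul]
  linear_combination (-t ^ 2) * hu - hv - 2 * t * huv - ((t - β) ^ 2 + γ ^ 2) * e3

open Polynomial in
lemma tq_main (Q Cm D : ℝ[X]) (hdeg : Q.natDegree ≤ 2)
    (h : ∀ x t : ℝ, 0 ≤ x ^ 2 * Q.eval t + 2 * x * Cm.eval t + D.eval t) :
    ∃ l₁ l₂ l₃ m₁ m₂ m₃ : ℝ[X], Q = l₁ ^ 2 + l₂ ^ 2 + l₃ ^ 2 ∧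
      Cm = l₁ * m₁ + l₂ * m₂ + l₃ * m₃ ∧ D = m₁ ^ 2 + m₂ ^ 2 + m₃ ^ 2 := by
  have hS : ∀ t, 0 ≤ (Q * D - Cm ^ 2).eval t := by
    intro t
    have h1 := discrim_le_zero (a := Q.eval t) (b := 2 * Cm.eval t) (c := D.eval t)
      (fun x => by have := h x t; nlinarith)
    simp only [discrim] at h1
    simp only [eval_sub, eval_mul, eval_pow]
    nlinarith
  have hD : ∀ t, 0 ≤ D.eval t := fun t => by simpa using h 0 t
  have hQ : ∀ t, 0 ≤ Q.eval t := by
    intro t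
    by_contra hlt
    push Not at hlt
    have h1 := hS t
    have h2 := hD t
    have h3 := h 1 t
    have h4 := h (-1) t
    simp only [eval_sub, eval_mul, eval_pow] at h1
    have h5 : eval t Cm = 0 := by nlinarith [sq_nonneg (eval t Cm), mul_nonneg h2 (neg_nonneg.mpr hlt.le)]
    have h6 := h (1 + D.eval t / (- Q.eval t)) t
    have h7 : 0 ≤ D.eval t / (- Q.eval t) := div_nonneg h2 (by linarith)
    have h8 : D.eval t / (- Q.eval t) * Q.eval t = - D.eval t := by
      have := hlt.ne
      field_simp
    rw [h5] at h6
    generalize D.eval t / (- Q.eval t) = w at *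
    nlinarith [mul_nonneg h7 (neg_nonneg.mpr hlt.le), mul_nonneg (mul_nonneg h7 h7) (neg_nonneg.mpr hlt.le)]
  -- the square case
  have hsquare : ∀ l : ℝ[X], l ≠ 0 → Q = l ^ 2 → l ∣ Cm → 
      ∃ l₁ l₂ l₃ m₁ m₂ m₃ : ℝ[X], Q = l₁ ^ 2 + l₂ ^ 2 + l₃ ^ 2 ∧
      Cm = l₁ * m₁ + l₂ * m₂ + l₃ * m₃ ∧ D = m₁ ^ 2 + m₂ ^ 2 + m₃ ^ 2 := by
    rintro l hl0 hl ⟨E, hE⟩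
    have : ∀ t, 0 ≤ (D - E ^ 2).eval t := by
      apply tq_nonneg_of_mul (l ^ 2) _ (pow_ne_zero _ hl0)
      · intro t; rw [eval_pow]; positivity
      · intro t
        have := hS t
        rw [hl, hE] at this
        convert this using 2
        ring
    obtain ⟨A, B, hAB⟩ := tq_two_squares _ this
    refine ⟨l, 0, 0, E, A, B, by rw [hl]; ring, by rw [hE]; ring, ?_⟩
    linear_combination hAB
  obtain ⟨a, b, c, hQe⟩ : ∃ a b c : ℝ, Q = C a * X ^ 2 + C b * X + C c := by
    refine ⟨Q.coeff 2, Q.coeff 1, Q.coeff 0, ?_⟩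
    conv_lhs => rw [Q.as_sum_range_C_mul_X_pow' (n := 3) (by omega)]
    simp [Finset.sum_range_succ]; ring
  have hQt : ∀ t, 0 ≤ a * (t * t) + b * t + c := by
    intro t; have := hQ t; rw [hQe] at this; simp at this; nlinarith
  have hdisc := discrim_le_zero hQt
  simp only [discrim] at hdisc
  have hc : 0 ≤ c := by simpa using hQt 0
  have ha : 0 ≤ a := by
    by_contra hlt
    push Not at hlt
    have hb : b = 0 := by nlinarith [sq_nonneg b, mul_nonneg hc (neg_nonneg.mpr hlt.le)]
    subst hb
    have := hQt (1 + c / (-a))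
    have h7 : 0 ≤ c / (-a) := div_nonneg hc (by linarith)
    have h8 : c / (-a) * a = -c := by
      have := hlt.ne
      field_simp
    generalize c / (-a) = w at *
    nlinarith [mul_nonneg h7 (neg_nonneg.mpr hlt.le), mul_nonneg (mul_nonneg h7 h7) (neg_nonneg.mpr hlt.le)]
  rcases ha.eq_or_lt with ha0 | hapos
  · have hb : b = 0 := by rw [← ha0] at hdisc; nlinarith [sq_nonneg b]
    rcases hc.eq_or_lt with hc0 | hcpos
    · have hQ0 : Q = 0 := by rw [hQe, ← ha0, hb, ← hc0]; simp
      have hC0 : Cm = 0 := by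
        apply Polynomial.funext
        intro t
        have := hS t
        rw [hQ0] at this
        simp only [eval_sub, eval_mul, eval_pow, eval_zero] at this ⊢
        nlinarith [sq_nonneg (eval t Cm)]
      obtain ⟨A, B, hAB⟩ := tq_two_squares D hD
      exact ⟨0, 0, 0, A, B, 0, by rw [hQ0]; ring, by rw [hC0]; ring, by rw [hAB]; ring⟩
    · have hs : Real.sqrt c ≠ 0 := (Real.sqrt_pos.mpr hcpos).ne'
      apply hsquare (C (Real.sqrt c)) (by simpa using hs)
      · rw [← C_pow, Real.sq_sqrt hc, hQe, ← ha0, hb]; simp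
      · exact (isUnit_C.mpr (isUnit_iff_ne_zero.mpr hs)).dvd
  set β := - b / (2 * a) with hβ
  have hQe2 : Q = C a * ((X - C β) ^ 2 + C ((4 * a * c - b ^ 2) / (4 * a ^ 2))) := by
    rw [hQe]
    apply Polynomial.funext
    intro t
    simp only [eval_add, eval_pow, eval_sub, eval_X, eval_C, eval_mul, hβ]
    field_simp
    ring
  have hsa : Real.sqrt a ≠ 0 := (Real.sqrt_pos.mpr hapos).ne'
  rcases hdisc.eq_or_lt with hd0 | hdneg
  · have hd0' : 4 * a * c - b ^ 2 = 0 := by linarith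
    rw [hd0'] at hQe2
    apply hsquare (C (Real.sqrt a) * (X - C β))
    · exact mul_ne_zero (by simpa using hsa) (X_sub_C_ne_zero β)
    · rw [mul_pow, ← C_pow, Real.sq_sqrt ha, hQe2]; simp
    · have hu : IsUnit (C (Real.sqrt a)) := isUnit_C.mpr (isUnit_iff_ne_zero.mpr hsa)
      rw [hu.mul_left_dvd, dvd_iff_isRoot]
      have := hS β
      rw [hQe2] at this
      simp at this
      show Cm.eval β = 0
      nlinarith [sq_nonneg (eval β Cm)]
  · have hpos : 0 < (4 * a * c - b ^ 2) / (4 * a ^ 2) := by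
      apply div_pos <;> nlinarith
    set γ := Real.sqrt ((4 * a * c - b ^ 2) / (4 * a ^ 2)) with hγ
    have hγ2 : γ ^ 2 = (4 * a * c - b ^ 2) / (4 * a ^ 2) := Real.sq_sqrt hpos.le
    have hγ0 : 0 < γ := Real.sqrt_pos.mpr hpos
    rw [← hγ2] at hQe2
    obtain ⟨T, m, hT⟩ := tq_norm Q (by rw [hQe2]; exact tq_pencil a β γ hapos hγ0) _ _ le_rfl hS
    have hQd : Q.natDegree = 2 := by
      rw [hQe]; compute_degree!; exact hapos.ne'
    have hQ0 : Q ≠ 0 := by intro h; rw [h] at hQd; simp at hQd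
    have hQpos : ∀ t, Q.eval t ≠ 0 := by
      intro t
      rw [hQe2]; simp
      exact ⟨hapos.ne', by positivity⟩
    have hprime : Prime Q := by
      apply Irreducible.prime
      rw [irreducible_iff_roots_eq_zero_of_degree_le_three (by omega) (by omega)]
      rw [Multiset.eq_zero_iff_forall_notMem]
      intro t ht
      exact hQpos t (isRoot_of_mem_roots ht)
    set l₁ := C (Real.sqrt a) * (X - C β) with hl₁
    set l₂ : ℝ[X] := C (Real.sqrt a * γ) with hl₂
    have hl : Q = l₁ ^ 2 + l₂ ^ 2 := by
      rw [hQe2, hl₁, hl₂, mul_pow, ← C_pow, Real.sq_sqrt ha, ← C_pow, mul_pow, Real.sq_sqrt ha]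
      simp; ring
    have hndvd : ¬ Q ∣ l₁ := by
      intro hdvd
      have h1 := natDegree_le_of_dvd hdvd (mul_ne_zero (by simpa using hsa) (X_sub_C_ne_zero β))
      have h2 : l₁.natDegree ≤ 1 := by rw [hl₁]; compute_degree
      omega
    have key : ∀ T : ℝ[X], Q * D - Cm ^ 2 = T ^ 2 + Q * m ^ 2 → Q ∣ l₁ * Cm + l₂ * T →
        ∃ l₁ l₂ l₃ m₁ m₂ m₃ : ℝ[X], Q = l₁ ^ 2 + l₂ ^ 2 + l₃ ^ 2 ∧
      Cm = l₁ * m₁ + l₂ * m₂ + l₃ * m₃ ∧ D = m₁ ^ 2 + m₂ ^ 2 + m₃ ^ 2 := by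
      rintro T hT ⟨m₁, hm₁⟩
      have : Q ∣ l₁ * (l₂ * Cm - l₁ * T) := ⟨l₂ * m₁ - T, by
        linear_combination l₂ * hm₁ + T * hl⟩
      obtain ⟨m₂, hm₂⟩ := (hprime.dvd_mul.mp this).resolve_left hndvd
      refine ⟨l₁, l₂, 0, m₁, m₂, m, by rw [hl]; ring, ?_, ?_⟩
      · apply mul_left_cancel₀ hQ0
        linear_combination l₁ * hm₁ + l₂ * hm₂ + Cm * hl
      · apply mul_left_cancel₀ (pow_ne_zero 2 hQ0)
        linear_combination Q * hT + (l₁ * Cm + l₂ * T + Q * m₁) * hm₁ + (l₂ * Cm - l₁ * T + Q * m₂) * hm₂ + (Cm ^ 2 + T ^ 2) * hl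
    have hdv : Q ∣ (l₁ * Cm + l₂ * T) * (l₁ * Cm + l₂ * (-T)) :=
      ⟨l₁ ^ 2 * (D - m ^ 2) - T ^ 2, by linear_combination (-l₁ ^ 2) * hT + T ^ 2 * hl⟩
    rcases hprime.dvd_or_dvd hdv with h1 | h1
    · exact key T hT h1
    · exact key (-T) (by rw [hT]; ring) h1

open Polynomial in
lemma tq_deg (A B E : ℝ[X]) (k : ℕ) (h : (A ^ 2 + B ^ 2 + E ^ 2).natDegree ≤ 2 * k) :
    A.natDegree ≤ k ∧ B.natDegree ≤ k ∧ E.natDegree ≤ k := by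
  by_contra hcon
  set n := max A.natDegree (max B.natDegree E.natDegree) with hn
  have hA : A.natDegree ≤ n := le_max_left _ _
  have hB : B.natDegree ≤ n := (le_max_left _ _).trans (le_max_right _ _)
  have hE : E.natDegree ≤ n := (le_max_right _ _).trans (le_max_right _ _)
  have hk : k < n := by
    by_contra h
    exact hcon ⟨by omega, by omega, by omega⟩
  have hc : (A ^ 2 + B ^ 2 + E ^ 2).coeff (2 * n) = 0 :=
    coeff_eq_zero_of_natDegree_lt (by omega)
  have h2 : ∀ P : ℝ[X], P.natDegree ≤ n → (P ^ 2).coeff (2 * n) = P.coeff n ^ 2 := by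
    intro P hP
    exact coeff_pow_of_natDegree_le hP
  rw [coeff_add, coeff_add, h2 _ hA, h2 _ hB, h2 _ hE] at hc
  have a0 : A.coeff n = 0 := by nlinarith [sq_nonneg (A.coeff n), sq_nonneg (B.coeff n), sq_nonneg (E.coeff n)]
  have b0 : B.coeff n = 0 := by nlinarith [sq_nonneg (A.coeff n), sq_nonneg (B.coeff n), sq_nonneg (E.coeff n)]
  have e0 : E.coeff n = 0 := by nlinarith [sq_nonneg (A.coeff n), sq_nonneg (B.coeff n), sq_nonneg (E.coeff n)]
  have hl : ∀ P : ℝ[X], P.natDegree = n → P.coeff n ≠ 0 := by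
    intro P hP h0
    rw [← hP] at h0
    have : P = 0 := leadingCoeff_eq_zero.mp h0
    rw [this] at hP; simp at hP; omega
  rcases max_choice A.natDegree (max B.natDegree E.natDegree) with hma | hma
  · exact hl A (by omega) a0
  · rcases max_choice B.natDegree E.natDegree with hmb | hmb
    · exact hl B (by omega) b0
    · exact hl E (by omega) e0

lemma tq_extract (p : MvPolynomial (Fin 3) ℝ) (hp : p.IsHomogeneous 4) :
    ∃ K : ℕ → Polynomial ℝ, (∀ j, j ≤ 4 → (K j).natDegree ≤ 4 - j) ∧
      (∀ x t : ℝ, MvPolynomial.eval ![x, t, 1] p =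
        ∑ j ∈ Finset.range 5, x ^ j * (K j).eval t) ∧
      (K 4).eval 0 = MvPolynomial.eval ![1, 0, 0] p := by
  have hd : ∀ d ∈ p.support, d 0 + d 1 + d 2 = 4 := by
    intro d hd
    have := hp.degree_eq_sum_deg_support hd
    rw [← Finsupp.degree_apply, Finsupp.degree_eq_sum, Fin.sum_univ_three] at this
    exact this.symm
  refine ⟨fun j => ∑ d ∈ p.support with d 0 = j,
    Polynomial.C (p.coeff d) * Polynomial.X ^ (d 1), ?_, ?_, ?_⟩
  · intro j hj
    apply Polynomial.natDegree_sum_le_of_forall_le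
    intro d hdm
    rw [Finset.mem_filter] at hdm
    have := hd d hdm.1
    refine (Polynomial.natDegree_C_mul_X_pow_le _ _).trans ?_
    omega
  · intro x t
    rw [MvPolynomial.eval_eq']
    have hmaps : ∀ d ∈ p.support, d 0 ∈ Finset.range 5 := by
      intro d hdm
      have := hd d hdm
      rw [Finset.mem_range]; omega
    rw [← Finset.sum_fiberwise_of_maps_to hmaps]
    apply Finset.sum_congr rfl
    intro j _
    rw [Polynomial.eval_finsetSum, Finset.mul_sum]
    apply Finset.sum_congr rfl
    intro d hdm
    rw [Finset.mem_filter] at hdm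
    simp [Fin.prod_univ_three, hdm.2]
    ring
  · rw [MvPolynomial.eval_eq', Polynomial.eval_finsetSum, Finset.sum_filter]
    apply Finset.sum_congr rfl
    intro d hdm
    have := hd d hdm
    split_ifs with h4
    · have h1 : d 1 = 0 := by omega
      have h2 : d 2 = 0 := by omega
      simp [Fin.prod_univ_three, h1, h2]
    · have : d 1 ≠ 0 ∨ d 2 ≠ 0 := by omega
      rcases this with h | h <;> simp [Fin.prod_univ_three, h]

/-- Homogenization of `x * l + m`. -/
noncomputable def tqHom (l m : Polynomial ℝ) : MvPolynomial (Fin 3) ℝ :=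
  MvPolynomial.X 0 * (MvPolynomial.C (l.coeff 1) * MvPolynomial.X 1
    + MvPolynomial.C (l.coeff 0) * MvPolynomial.X 2)
  + (MvPolynomial.C (m.coeff 2) * MvPolynomial.X 1 ^ 2
    + MvPolynomial.C (m.coeff 1) * (MvPolynomial.X 1 * MvPolynomial.X 2)
    + MvPolynomial.C (m.coeff 0) * MvPolynomial.X 2 ^ 2)

lemma tqHom_isHomogeneous (l m : Polynomial ℝ) : (tqHom l m).IsHomogeneous 2 := by
  unfold tqHom
  have hX : ∀ i : Fin 3, (MvPolynomial.X i : MvPolynomial (Fin 3) ℝ).IsHomogeneous 1 :=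
    fun i => MvPolynomial.isHomogeneous_X ℝ i
  refine MvPolynomial.IsHomogeneous.add ((hX 0).mul (((hX 1).C_mul _).add ((hX 2).C_mul _))) ?_
  exact ((((hX 1).pow 2).C_mul _).add (((hX 1).mul (hX 2)).C_mul _)).add (((hX 2).pow 2).C_mul _)

lemma tqHom_eval (l m : Polynomial ℝ) (hl : l.natDegree ≤ 1) (hm : m.natDegree ≤ 2) (x t : ℝ) :
    MvPolynomial.eval ![x, t, 1] (tqHom l m) = x * l.eval t + m.eval t := by
  rw [Polynomial.eval_eq_sum_range' (n := 2) (by omega : l.natDegree < 2),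
    Polynomial.eval_eq_sum_range' (n := 3) (by omega : m.natDegree < 3)]
  simp [tqHom, Finset.sum_range_succ]
  ring

lemma tq_hom_smul (p : MvPolynomial (Fin 3) ℝ) (n : ℕ) (hp : p.IsHomogeneous n) (c : ℝ)
    (x : Fin 3 → ℝ) : MvPolynomial.eval (fun i => c * x i) p = c ^ n * MvPolynomial.eval x p := by
  rw [MvPolynomial.eval_eq', MvPolynomial.eval_eq', Finset.mul_sum]
  apply Finset.sum_congr rfl
  intro d hd
  have := hp.degree_eq_sum_deg_support hd
  rw [← Finsupp.degree_apply, Finsupp.degree_eq_sum] at this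
  simp only [mul_pow, Finset.prod_mul_distrib, Finset.prod_pow_eq_pow_sum, ← this]
  ring

lemma tq_cubic (k q c d : ℝ) (h : ∀ x : ℝ, 0 ≤ x ^ 3 * k + x ^ 2 * q + x * c + d) : k = 0 := by
  by_contra hk
  set M := |q| + |c| + |d| + 1 with hM
  have hq := abs_nonneg q
  have hc := abs_nonneg c
  have hd := abs_nonneg d
  have hM1 : 1 ≤ M := by linarith
  set K := max 1 (1 / |k|)
  have hK1 : 1 ≤ K := le_max_left _ _
  have hkK : 1 ≤ |k| * K := by
    have : 1 / |k| ≤ K := le_max_right _ _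
    have hk' : 0 < |k| := abs_pos.mpr hk
    rw [div_le_iff₀ hk'] at this
    linarith
  have hX1 : 1 ≤ M * K := by nlinarith
  -- the size estimate
  have key : ∀ s : ℝ, s ^ 2 = 1 → s * k = -|k| → False := by
    intro s hs hsk
    have := h (s * (M * K))
    generalize hX : M * K = X at *
    have e1 : |k| * X ≥ M := by rw [← hX]; nlinarith
    have hsabs : |s| = 1 := by
      rw [← sq_eq_sq₀ (abs_nonneg _) zero_le_one, sq_abs, hs]; norm_num
    have e2 : (s * X) ^ 3 * k = - (|k| * X) * X ^ 2 := by
      have : (s * X) ^ 3 * k = s ^ 2 * (s * k) * X ^ 3 := by ring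
      rw [this, hs, hsk]; ring
    have e3 : (s * X) ^ 2 * q ≤ |q| * X ^ 2 := by
      rw [mul_pow, hs, one_mul, mul_comm]
      exact mul_le_mul_of_nonneg_right (le_abs_self q) (sq_nonneg _)
    have hXX : X ≤ X ^ 2 := by nlinarith
    have e4 : s * X * c ≤ |c| * X ^ 2 := by
      have : s * X * c ≤ |s * X * c| := le_abs_self _
      rw [abs_mul, abs_mul, hsabs, abs_of_nonneg (by linarith : 0 ≤ X)] at this
      nlinarith
    have e5 : d ≤ |d| * X ^ 2 := by
      have : d ≤ |d| := le_abs_self d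
      nlinarith
    rw [e2] at this
    nlinarith
  rcases abs_choice k with hk' | hk'
  · exact key (-1) (by norm_num) (by linarith)
  · exact key 1 (by norm_num) (by linarith)

lemma tq_zero (p : MvPolynomial (Fin 3) ℝ) (hp : p.IsHomogeneous 4)
    (hpos : ∀ x : Fin 3 → ℝ, 0 ≤ MvPolynomial.eval x p)
    (hz : MvPolynomial.eval ![1, 0, 0] p = 0) :
    ∃ q₁ q₂ q₃ : MvPolynomial (Fin 3) ℝ,
      q₁.IsHomogeneous 2 ∧ q₂.IsHomogeneous 2 ∧ q₃.IsHomogeneous 2 ∧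
      p = q₁ ^ 2 + q₂ ^ 2 + q₃ ^ 2 := by
  obtain ⟨K, hKd, hKe, hK4⟩ := tq_extract p hp
  rw [hz] at hK4
  have hK4' : K 4 = 0 := by
    have h0 := hKd 4 le_rfl
    obtain ⟨c, hc⟩ := Polynomial.natDegree_eq_zero.mp (by omega : (K 4).natDegree = 0)
    rw [← hc] at hK4 ⊢
    simp at hK4
    simp [hK4]
  have hform : ∀ x t : ℝ, MvPolynomial.eval ![x, t, 1] p =
      x ^ 3 * (K 3).eval t + x ^ 2 * (K 2).eval t + x * (K 1).eval t + (K 0).eval t := by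
    intro x t
    rw [hKe, Finset.sum_range_succ, Finset.sum_range_succ, Finset.sum_range_succ,
      Finset.sum_range_succ, Finset.sum_range_succ, hK4']
    simp
    ring
  have hK3 : ∀ t, (K 3).eval t = 0 := by
    intro t
    apply tq_cubic _ ((K 2).eval t) ((K 1).eval t) ((K 0).eval t)
    intro x
    rw [← hform]; exact hpos _
  obtain ⟨l₁, l₂, l₃, m₁, m₂, m₃, hQ, hC, hD⟩ := tq_main (K 2) (Polynomial.C (1 / 2) * K 1) (K 0)
    (hKd 2 (by norm_num)) (by
      intro x t
      have := hpos ![x, t, 1]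
      rw [hform, hK3] at this
      simp only [Polynomial.eval_mul, Polynomial.eval_C]
      linarith)
  obtain ⟨hl1, hl2, hl3⟩ := tq_deg l₁ l₂ l₃ 1 (by rw [← hQ]; exact hKd 2 (by norm_num))
  obtain ⟨hm1, hm2, hm3⟩ := tq_deg m₁ m₂ m₃ 2 (by rw [← hD]; exact hKd 0 (by norm_num))
  refine ⟨tqHom l₁ m₁, tqHom l₂ m₂, tqHom l₃ m₃, tqHom_isHomogeneous _ _,
    tqHom_isHomogeneous _ _, tqHom_isHomogeneous _ _, ?_⟩
  set R := tqHom l₁ m₁ ^ 2 + tqHom l₂ m₂ ^ 2 + tqHom l₃ m₃ ^ 2 with hR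
  have hRhom : R.IsHomogeneous 4 :=
    (((tqHom_isHomogeneous l₁ m₁).pow 2).add ((tqHom_isHomogeneous l₂ m₂).pow 2)).add
      ((tqHom_isHomogeneous l₃ m₃).pow 2)
  have haff : ∀ x t : ℝ, MvPolynomial.eval ![x, t, 1] p = MvPolynomial.eval ![x, t, 1] R := by
    intro x t
    have e1 := congrArg (Polynomial.eval t) hQ
    have e2 := congrArg (Polynomial.eval t) hC
    have e3 := congrArg (Polynomial.eval t) hD
    simp only [Polynomial.eval_add, Polynomial.eval_mul, Polynomial.eval_pow,
      Polynomial.eval_C] at e1 e2 e3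
    rw [hform, hK3, hR]
    simp only [map_add, map_pow]
    rw [tqHom_eval _ _ hl1 hm1, tqHom_eval _ _ hl2 hm2, tqHom_eval _ _ hl3 hm3]
    linear_combination x ^ 2 * e1 + 2 * x * e2 + e3
  have hmul : (MvPolynomial.X 2 : MvPolynomial (Fin 3) ℝ) * p = MvPolynomial.X 2 * R := by
    apply MvPolynomial.funext
    intro v
    simp only [map_mul, MvPolynomial.eval_X]
    by_cases hv : v 2 = 0
    · simp [hv]
    · have hv' : v = fun i => v 2 * (![v 0 / v 2, v 1 / v 2, 1] : Fin 3 → ℝ) i := by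
        ext i
        fin_cases i <;> simp <;> field_simp
      congr 1
      rw [hv', tq_hom_smul p 4 hp, tq_hom_smul R 4 hRhom, haff]
  exact mul_left_cancel₀ (MvPolynomial.X_ne_zero 2) hmul

lemma tq_zero_general (p : MvPolynomial (Fin 3) ℝ) (hp : p.IsHomogeneous 4)
    (hpos : ∀ x : Fin 3 → ℝ, 0 ≤ MvPolynomial.eval x p) (v : Fin 3 → ℝ) (hv : v ≠ 0)
    (hz : MvPolynomial.eval v p = 0) :
    ∃ q₁ q₂ q₃ : MvPolynomial (Fin 3) ℝ,
      q₁.IsHomogeneous 2 ∧ q₂.IsHomogeneous 2 ∧ q₃.IsHomogeneous 2 ∧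
      p = q₁ ^ 2 + q₂ ^ 2 + q₃ ^ 2 := by
  have he : (![1, 0, 0] : Fin 3 → ℝ) ≠ 0 := by
    intro h
    have := congrFun h 0
    simp at this
  obtain ⟨A, hA⟩ := SeparatingDual.exists_continuousLinearEquiv_apply_eq (R := ℝ) he hv
  let g : ((Fin 3 → ℝ) →ₗ[ℝ] (Fin 3 → ℝ)) → Fin 3 → MvPolynomial (Fin 3) ℝ := fun B i =>
    ∑ j, MvPolynomial.C (B (Pi.single j 1) i) * MvPolynomial.X j
  have hg1 : ∀ B i, (g B i).IsHomogeneous 1 := by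
    intro B i
    apply MvPolynomial.IsHomogeneous.sum
    intro j _
    exact (MvPolynomial.isHomogeneous_X ℝ j).C_mul _
  have hge : ∀ B x (q : MvPolynomial (Fin 3) ℝ),
      MvPolynomial.eval x (MvPolynomial.aeval (g B) q) = MvPolynomial.eval (B x) q := by
    intro B x q
    have h1 : (fun i => MvPolynomial.eval x (g B i)) = B x := by
      ext i
      have hx : x = ∑ j, x j • (Pi.single j (1 : ℝ) : Fin 3 → ℝ) := by
        ext k
        simp [Pi.single_apply]
      conv_rhs => rw [hx]
      simp [g, mul_comm]
    rw [← h1]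
    induction q using MvPolynomial.induction_on with
    | C a => simp
    | add p q hp hq => rw [map_add, map_add, map_add, hp, hq]
    | mul_X p i hp =>
      rw [map_mul, map_mul, map_mul, hp, MvPolynomial.aeval_X, MvPolynomial.eval_X]
  have hgh : ∀ B (q : MvPolynomial (Fin 3) ℝ) n, q.IsHomogeneous n →
      (MvPolynomial.aeval (g B) q).IsHomogeneous n := by
    intro B q n hq
    simpa using hq.aeval (g B) (hg1 B)
  obtain ⟨q₁, q₂, q₃, h1, h2, h3, hq⟩ := tq_zero (MvPolynomial.aeval (g A.toLinearMap) p)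
    (hgh _ _ _ hp) (fun x => by rw [hge]; exact hpos _) (by
      rw [hge]
      show MvPolynomial.eval (A ![1, 0, 0]) p = 0
      rw [hA, hz])
  refine ⟨MvPolynomial.aeval (g A.symm.toLinearMap) q₁, MvPolynomial.aeval (g A.symm.toLinearMap) q₂,
    MvPolynomial.aeval (g A.symm.toLinearMap) q₃, hgh _ _ _ h1, hgh _ _ _ h2, hgh _ _ _ h3, ?_⟩
  rw [← map_pow, ← map_pow, ← map_pow, ← map_add, ← map_add, ← hq]
  apply MvPolynomial.funext
  intro x
  rw [hge, hge]
  have hx : A.toLinearMap (A.symm.toLinearMap x) = x := A.apply_symm_apply x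
  rw [hx]

/-- Every nonnegative ternary quartic is a sum of (at most) four squares of
homogeneous quadratic polynomials. -/
theorem nonneg_ternary_quartic_is_sum_of_four_squares
    (p : MvPolynomial (Fin 3) ℝ) (hhom : p.IsHomogeneous 4)
    (hpos : ∀ x : Fin 3 → ℝ, 0 ≤ MvPolynomial.eval x p) :
    ∃ q₁ q₂ q₃ q₄ : MvPolynomial (Fin 3) ℝ,
      q₁.IsHomogeneous 2 ∧ q₂.IsHomogeneous 2 ∧ q₃.IsHomogeneous 2 ∧
      q₄.IsHomogeneous 2 ∧ p = q₁ ^ 2 + q₂ ^ 2 + q₃ ^ 2 + q₄ ^ 2 := by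
  let N : MvPolynomial (Fin 3) ℝ := ∑ i, MvPolynomial.X i ^ 2
  have hN : N.IsHomogeneous 2 := by
    apply MvPolynomial.IsHomogeneous.sum
    intro i _
    exact MvPolynomial.isHomogeneous_X_pow i 2
  have hNe : ∀ x, MvPolynomial.eval x N = x 0 ^ 2 + x 1 ^ 2 + x 2 ^ 2 := by
    intro x; simp [N, Fin.sum_univ_three]
  let K : Set (Fin 3 → ℝ) := {x | MvPolynomial.eval x N = 1}
  have hcl : IsClosed K := isClosed_eq (MvPolynomial.continuous_eval N) continuous_const
  have hK : IsCompact K := by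
    apply (isCompact_closedBall (0 : Fin 3 → ℝ) 1).of_isClosed_subset hcl
    intro x hx
    have hx' : x 0 ^ 2 + x 1 ^ 2 + x 2 ^ 2 = 1 := by rw [← hNe]; exact hx
    rw [mem_closedBall_zero_iff, pi_norm_le_iff_of_nonneg zero_le_one]
    intro i
    rw [Real.norm_eq_abs, ← sq_le_one_iff_abs_le_one]
    have : ∀ j : Fin 3, x j ^ 2 ≤ x 0 ^ 2 + x 1 ^ 2 + x 2 ^ 2 := by
      have h0 := sq_nonneg (x 0)
      have h1 := sq_nonneg (x 1)
      have h2 := sq_nonneg (x 2)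
      rw [Fin.forall_fin_succ, Fin.forall_fin_two]
      refine ⟨by linarith, ?_, ?_⟩
      · show x 1 ^ 2 ≤ _
        linarith
      · show x 2 ^ 2 ≤ _
        linarith
    rw [← hx']; exact this i
  have hne : K.Nonempty := ⟨![1, 0, 0], by show MvPolynomial.eval _ N = 1; rw [hNe]; simp⟩
  obtain ⟨v, hvK, hvmin⟩ := hK.exists_isMinOn hne (MvPolynomial.continuous_eval p).continuousOn
  have hvK' : MvPolynomial.eval v N = 1 := hvK
  set s := MvPolynomial.eval v p with hs
  have hs0 : 0 ≤ s := hpos v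
  have hv0 : v ≠ 0 := by
    rintro rfl
    rw [hNe] at hvK'
    simp at hvK'
  let q₄ : MvPolynomial (Fin 3) ℝ := MvPolynomial.C (Real.sqrt s) * N
  have hq4 : q₄.IsHomogeneous 2 := hN.C_mul _
  have hq4e : ∀ x, MvPolynomial.eval x (q₄ ^ 2) = s * MvPolynomial.eval x N ^ 2 := by
    intro x
    simp only [q₄, map_pow, map_mul, MvPolynomial.eval_C]
    rw [mul_pow, Real.sq_sqrt hs0]
  obtain ⟨q₁, q₂, q₃, h1, h2, h3, hq⟩ := tq_zero_general (p - q₄ ^ 2)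
    (hhom.sub (hq4.pow 2)) (by
      intro x
      rw [map_sub, hq4e, sub_nonneg]
      by_cases hx : MvPolynomial.eval x N = 0
      · rw [hx]; simpa using hpos x
      · have hxp : 0 < MvPolynomial.eval x N := by
          refine lt_of_le_of_ne ?_ (Ne.symm hx)
          rw [hNe]; positivity
        set r := Real.sqrt (MvPolynomial.eval x N) with hr
        have hr0 : 0 < r := Real.sqrt_pos.mpr hxp
        have hr2 : r ^ 2 = MvPolynomial.eval x N := Real.sq_sqrt hxp.le
        have hmem : (fun i => r⁻¹ * x i) ∈ K := by
          show MvPolynomial.eval _ N = 1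
          rw [tq_hom_smul N 2 hN, ← hr2]
          field_simp
        have hle : s ≤ MvPolynomial.eval (fun i => r⁻¹ * x i) p := hvmin hmem
        rw [tq_hom_smul p 4 hhom] at hle
        rw [← hr2]
        calc s * (r ^ 2) ^ 2 ≤ (r⁻¹ ^ 4 * MvPolynomial.eval x p) * (r ^ 2) ^ 2 := by gcongr
          _ = MvPolynomial.eval x p := by field_simp)
    v hv0 (by rw [map_sub, hq4e, hvK', ← hs]; ring)
  exact ⟨q₁, q₂, q₃, q₄, h1, h2, h3, hq4, by rw [← hq]; ring⟩
end
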